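/- arXiv:2410.16968 — 6 statements merged into one kernel-verified Lean document; each statement's English description precedes it below -/
import Mathlib

section
/- Let σ ≥ 2, k ≥ 2, w ≥ 1, and let v be a σ-ary string of length w+k containing exactly t distinct k-substrings. If the length-k suffix of v occurs exactly once in v, then P_{σ,k}(v) = 2/t; otherwise P_{σ,k}(v) = 1/t. -/
open Finset

/-- The `i`-th length-`k` substring (`k`-mer) of a word of length `w + k`
over the alphabet `Fin σ`. -/
def kmerAt (σ k w : ℕ) (v : Fin (w + k) → Fin σ) (i : Fin (w + 1)) : Fin k → Fin σ :=
  fun j => v ⟨i.1 + j.1, by have h1 := i.2; have h2 := j.2; omega⟩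

/-- `v` is a gamechanger with respect to the linear order (ranking) `ρ` on `k`-mers:
either its `k`-prefix is a `ρ`-minimal `k`-mer of `v`, or its `k`-suffix is a
`ρ`-minimal `k`-mer of `v` occurring exactly once in `v`. -/
def IsGC (σ k w : ℕ) (ρ : (Fin k → Fin σ) ≃ Fin (σ ^ k)) (v : Fin (w + k) → Fin σ) : Prop :=
  (∀ i : Fin (w + 1), ρ (kmerAt σ k w v 0) ≤ ρ (kmerAt σ k w v i)) ∨
  ((∀ i : Fin (w + 1), ρ (kmerAt σ k w v (Fin.last w)) ≤ ρ (kmerAt σ k w v i)) ∧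
    (∀ i : Fin (w + 1), kmerAt σ k w v i = kmerAt σ k w v (Fin.last w) → i = Fin.last w))

/-- `P_{σ,k}(v)`: the fraction of linear orders `ρ` on `σ`-ary `k`-strings for which
`v` is a gamechanger. -/
noncomputable def Pgc (σ k w : ℕ) (v : Fin (w + k) → Fin σ) : ℝ :=
  (Nat.card {ρ : (Fin k → Fin σ) ≃ Fin (σ ^ k) // IsGC σ k w ρ v} : ℝ) /
    (Nat.card ((Fin k → Fin σ) ≃ Fin (σ ^ k)) : ℝ)

/-- `D_ρ`: the fraction of gamechangers among all `σ`-ary strings of length `w + k`. -/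
noncomputable def Dens (σ k w : ℕ) (ρ : (Fin k → Fin σ) ≃ Fin (σ ^ k)) : ℝ :=
  (Nat.card {v : Fin (w + k) → Fin σ // IsGC σ k w ρ v} : ℝ) / ((σ : ℝ) ^ (w + k))

/-- `DR_σ(k,w)`: the expected density, i.e. the average of `D_ρ` over all orders `ρ`. -/
noncomputable def DR (σ k w : ℕ) : ℝ :=
  (∑ ρ : (Fin k → Fin σ) ≃ Fin (σ ^ k), Dens σ k w ρ) /
    (Nat.card ((Fin k → Fin σ) ≃ Fin (σ ^ k)) : ℝ)

/-- `DFR_σ(k,w) = (w+1) · DR_σ(k,w)`, the expected density factor. -/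
noncomputable def DFR (σ k w : ℕ) : ℝ := ((w : ℝ) + 1) * DR σ k w

/-- The number of distinct `k`-mers of `v`. -/
def numKmers (σ k w : ℕ) (v : Fin (w + k) → Fin σ) : ℕ :=
  (Finset.univ.image (kmerAt σ k w v)).card

/-- `Rep_{σ,k,w}`: the set of `σ`-ary strings of length `w + k` that contain two equal
`k`-substrings at distinct positions. -/
def RepSet (σ k w : ℕ) : Finset (Fin (w + k) → Fin σ) :=
  Finset.univ.filter fun v =>
    ∃ i j : Fin (w + 1), i ≠ j ∧ kmerAt σ k w v i = kmerAt σ k w v j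

/-- `Dev_σ(k,w)`, the deviation of the random order. -/
noncomputable def Dev (σ k w : ℕ) : ℝ :=
  (∑ v ∈ RepSet σ k w, Pgc σ k w v) - (2 / ((w : ℝ) + 1)) * ((RepSet σ k w).card : ℝ)

/-- `p` is a period of the string `s` (of length `n`): `s[i] = s[i+p]` whenever both
positions are inside `s`. -/
def HasPeriod (σ n : ℕ) (s : Fin n → Fin σ) (p : ℕ) : Prop :=
  ∀ (i : ℕ) (h : i + p < n), s ⟨i, by omega⟩ = s ⟨i + p, h⟩

/-- A string is primitive if it is not of the form `u^m` with `m ≥ 2`, equivalently it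
has no period that is a proper divisor of its length. -/
def IsPrimitive (σ n : ℕ) (s : Fin n → Fin σ) : Prop :=
  ¬ ∃ d, d ∣ n ∧ d < n ∧ HasPeriod σ n s d

/-- `Prim_σ(n)`: the number of primitive `σ`-ary strings of length `n`. -/
noncomputable def Prim (σ n : ℕ) : ℕ :=
  Nat.card {s : Fin n → Fin σ // IsPrimitive σ n s}

/-- The substring of `v` of length `ℓ` starting at (0-indexed) position `i`. -/
def subAt (σ n : ℕ) (v : Fin n → Fin σ) (i ℓ : ℕ) (h : i + ℓ ≤ n) : Fin ℓ → Fin σ :=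
  fun j => v ⟨i + j.1, by have := j.2; omega⟩

/-- A string is `p`-periodic if `p` is its minimal period and `p ≤ |s|/2`. -/
def IsPPeriodic (σ n : ℕ) (s : Fin n → Fin σ) (p : ℕ) : Prop :=
  1 ≤ p ∧ 2 * p ≤ n ∧ HasPeriod σ n s p ∧ ∀ q, 1 ≤ q → q < p → ¬ HasPeriod σ n s q

/-- The occurrence `v[i..i+ℓ)` is a run of period `p`: it is `p`-periodic and is not
contained in a longer `p`-periodic substring of `v`. -/
def IsRun (σ n : ℕ) (v : Fin n → Fin σ) (i ℓ p : ℕ) (h : i + ℓ ≤ n) : Prop :=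
  IsPPeriodic σ ℓ (subAt σ n v i ℓ h) p ∧
    ∀ (i' ℓ' : ℕ) (h' : i' + ℓ' ≤ n), i' ≤ i → i + ℓ ≤ i' + ℓ' → ℓ < ℓ' →
      ¬ IsPPeriodic σ ℓ' (subAt σ n v i' ℓ' h') p

/-- A major run: a run `x` of period `p` with `|x| ≥ |v|/2 + p`. -/
def IsMajorRun (σ n : ℕ) (v : Fin n → Fin σ) (i ℓ p : ℕ) (h : i + ℓ ≤ n) : Prop :=
  IsRun σ n v i ℓ p h ∧ n + 2 * p ≤ 2 * ℓ

theorem card_min_mul {α : Type*} [Fintype α] [DecidableEq α] (N : ℕ) (S : Finset α) (a : α)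
    (ha : a ∈ S) :
    Nat.card {ρ : α ≃ Fin N // ∀ b ∈ S, ρ a ≤ ρ b} * S.card = Nat.card (α ≃ Fin N) := by
  classical
  have hsymm : ∀ b ∈ S, Nat.card {ρ : α ≃ Fin N // ∀ c ∈ S, ρ b ≤ ρ c}
      = Nat.card {ρ : α ≃ Fin N // ∀ c ∈ S, ρ a ≤ ρ c} := by
    intro b hb
    have hsw : ∀ c ∈ S, Equiv.swap a b c ∈ S := by
      intro c hc
      rw [Equiv.swap_apply_def]
      split_ifs <;> assumption
    refine Nat.card_congr (Equiv.subtypeEquiv (Equiv.equivCongr (Equiv.swap a b) (Equiv.refl _)) ?_)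
    intro ρ
    simp only [Equiv.equivCongr_apply_apply, Equiv.symm_swap, Equiv.swap_apply_left,
      Equiv.refl_apply]
    constructor
    · intro h c hc
      exact h _ (hsw c hc)
    · intro h c hc
      simpa using h _ (hsw c hc)
  let e : (Σ b : S, {ρ : α ≃ Fin N // ∀ c ∈ S, ρ b ≤ ρ c}) → (α ≃ Fin N) := fun x => x.2.1
  have he : Function.Bijective e := by
    constructor
    · rintro ⟨⟨b, hb⟩, ρ, h⟩ ⟨⟨b', hb'⟩, ρ', h'⟩ heq
      have heq' : ρ = ρ' := heq
      subst heq'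
      have hbb : b = b' := ρ.injective (le_antisymm (h _ hb') (h' _ hb))
      subst hbb
      rfl
    · intro ρ
      obtain ⟨b, hb, h⟩ := S.exists_min_image ρ ⟨a, ha⟩
      exact ⟨⟨⟨b, hb⟩, ρ, h⟩, rfl⟩
  rw [← Nat.card_congr (Equiv.ofBijective e he), Nat.card_sigma,
    Finset.sum_congr rfl (fun b _ => hsymm b.1 b.2)]
  simp [mul_comm]

theorem stmt0 (σ k w t : ℕ) (hσ : 2 ≤ σ) (hk : 2 ≤ k) (hw : 1 ≤ w)
    (v : Fin (w + k) → Fin σ) (ht : numKmers σ k w v = t) :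
    ((∀ i : Fin (w + 1), kmerAt σ k w v i = kmerAt σ k w v (Fin.last w) → i = Fin.last w) →
      Pgc σ k w v = 2 / (t : ℝ)) ∧
    (¬ (∀ i : Fin (w + 1), kmerAt σ k w v i = kmerAt σ k w v (Fin.last w) → i = Fin.last w) →
      Pgc σ k w v = 1 / (t : ℝ)) := by
  classical
  set S : Finset (Fin k → Fin σ) := Finset.univ.image (kmerAt σ k w v) with hS
  have hmem : ∀ i, kmerAt σ k w v i ∈ S := fun i => Finset.mem_image_of_mem _ (Finset.mem_univ i)
  have hSt : S.card = t := ht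
  have hall : ∀ (ρ : (Fin k → Fin σ) ≃ Fin (σ ^ k)) (a : Fin k → Fin σ),
      (∀ i : Fin (w + 1), ρ a ≤ ρ (kmerAt σ k w v i)) ↔ ∀ b ∈ S, ρ a ≤ ρ b := by
    intro ρ a
    simp [hS]
  have htpos : (t : ℝ) ≠ 0 := by
    have : 0 < S.card := Finset.card_pos.mpr ⟨_, hmem 0⟩
    rw [hSt] at this
    exact_mod_cast this.ne'
  have hN : (Nat.card ((Fin k → Fin σ) ≃ Fin (σ ^ k)) : ℝ) ≠ 0 := by
    have hne : Nonempty ((Fin k → Fin σ) ≃ Fin (σ ^ k)) :=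
      ⟨Fintype.equivFinOfCardEq (by simp)⟩
    exact_mod_cast (Nat.card_pos (α := (Fin k → Fin σ) ≃ Fin (σ ^ k))).ne'
  have h0 := card_min_mul (σ ^ k) S _ (hmem 0)
  have h1 := card_min_mul (σ ^ k) S _ (hmem (Fin.last w))
  rw [hSt] at h0 h1
  have h0' := congrArg (Nat.cast : ℕ → ℝ) h0
  have h1' := congrArg (Nat.cast : ℕ → ℝ) h1
  push_cast at h0' h1'
  constructor
  · intro hu
    have hne : kmerAt σ k w v 0 ≠ kmerAt σ k w v (Fin.last w) := by
      intro h
      have := congrArg Fin.val (hu 0 h)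
      simp at this
      omega
    have hc : Nat.card {ρ : (Fin k → Fin σ) ≃ Fin (σ ^ k) // IsGC σ k w ρ v} =
        Nat.card {ρ : (Fin k → Fin σ) ≃ Fin (σ ^ k) // ∀ b ∈ S, ρ (kmerAt σ k w v 0) ≤ ρ b} +
        Nat.card {ρ : (Fin k → Fin σ) ≃ Fin (σ ^ k) //
          ∀ b ∈ S, ρ (kmerAt σ k w v (Fin.last w)) ≤ ρ b} := by
      rw [← Nat.card_sum]
      refine Nat.card_congr ((Equiv.subtypeEquivRight ?_).trans (subtypeOrEquiv _ _ ?_))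
      · intro ρ
        unfold IsGC
        rw [hall, hall, and_iff_left hu]
      · rw [Pi.disjoint_iff]
        intro ρ
        rw [Prop.disjoint_iff]
        intro hcon
        have hh : (∀ b ∈ S, ρ (kmerAt σ k w v 0) ≤ ρ b) ∧
          (∀ b ∈ S, ρ (kmerAt σ k w v (Fin.last w)) ≤ ρ b) := hcon
        exact hne (ρ.injective (le_antisymm (hh.1 _ (hmem _)) (hh.2 _ (hmem _))))
    unfold Pgc
    rw [div_eq_div_iff hN htpos, hc]
    push_cast
    linarith
  · intro hu
    have hc : Nat.card {ρ : (Fin k → Fin σ) ≃ Fin (σ ^ k) // IsGC σ k w ρ v} =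
        Nat.card {ρ : (Fin k → Fin σ) ≃ Fin (σ ^ k) //
          ∀ b ∈ S, ρ (kmerAt σ k w v 0) ≤ ρ b} := by
      refine Nat.card_congr (Equiv.subtypeEquivRight ?_)
      intro ρ
      unfold IsGC
      rw [hall, or_iff_left (fun h => hu h.2)]
    unfold Pgc
    rw [div_eq_div_iff hN htpos, hc]
    linarith
end

section
/- Every string contains at most one major run: if x₁ and x₂ are both major runs in a string v, then x₁ and x₂ are the same occurrence of the same substring in v. -/
open Finset

def PerOn (f : ℕ → ℕ) (a b p : ℕ) : Prop := ∀ x, a ≤ x → x + p < b → f x = f (x + p)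

def extF (σ n : ℕ) (v : Fin n → Fin σ) (x : ℕ) : ℕ := if h : x < n then (v ⟨x, h⟩).1 else 0

theorem hasPeriod_iff_perOn (σ n : ℕ) (v : Fin n → Fin σ) (i l p : ℕ) (h : i + l ≤ n) :
    HasPeriod σ l (subAt σ n v i l h) p ↔ PerOn (extF σ n v) i (i + l) p := by
  constructor
  · intro H x hx hxp
    obtain ⟨j, rfl⟩ := Nat.exists_eq_add_of_le hx
    have h1 := H j (by omega)
    have e1 : i + j < n := by omega
    have e2 : i + j + p < n := by omega
    simp only [extF, e1, e2, dif_pos]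
    simp only [subAt] at h1
    rw [h1]
    simp only [Nat.add_assoc]
  · intro H j hj
    have h1 := H (i + j) (by omega) (by omega)
    have e1 : i + j < n := by omega
    have e2 : i + j + p < n := by omega
    simp only [extF, e1, e2, dif_pos] at h1
    apply Fin.ext
    simp only [subAt]
    rw [h1]
    simp only [Nat.add_assoc]

theorem fineWilf (f : ℕ → ℕ) (a b : ℕ) : ∀ N p q : ℕ, p + q ≤ N → 1 ≤ p → 1 ≤ q →
    a + p + q ≤ b → PerOn f a b p → PerOn f a b q → PerOn f a b (Nat.gcd p q) := by
  have key : ∀ p q : ℕ, p < q → a + p + q ≤ b → PerOn f a b p → PerOn f a b q →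
      PerOn f a b (q - p) := by
    intro p q hpq hab hp hq x hx hxb
    by_cases hc : x + q < b
    · rw [hq x hx hc, hp (x + (q - p)) (by omega) (by omega)]
      congr 1; omega
    · have h1 := hp (x - p) (by omega) (by omega)
      have h2 := hq (x - p) (by omega) (by omega)
      rw [show x - p + p = x by omega] at h1
      rw [show x - p + q = x + (q - p) by omega] at h2
      rw [← h1, h2]
  intro N
  induction N with
  | zero => intro p q; omega
  | succ N ih =>
    intro p q hN hp1 hq1 hab hp hq
    rcases lt_trichotomy p q with hlt | rfl | hlt
    · have := ih p (q - p) (by omega) hp1 (by omega) (by omega) hp (key p q hlt hab hp hq)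
      rwa [Nat.gcd_sub_self_right hlt.le] at this
    · rwa [Nat.gcd_self]
    · have := ih (p - q) q (by omega) (by omega) hq1 (by omega)
        (key q p hlt (by omega) hq hp) hq
      rwa [Nat.gcd_sub_self_left hlt.le] at this

theorem perOn_mod (f : ℕ → ℕ) (a b p : ℕ) (hp : PerOn f a b p) (x y : ℕ)
    (hx : a ≤ x) (hxb : x < b) (hy : a ≤ y) (hyb : y < b) (h : x ≡ y [MOD p]) : f x = f y := by
  have key : ∀ k x : ℕ, a ≤ x → x + p * k < b → f x = f (x + p * k) := by
    intro k
    induction k with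
    | zero => intro x _ _; simp
    | succ k ih =>
      intro x hx hb
      rw [Nat.mul_succ] at hb ⊢
      rw [ih x hx (by omega), hp _ (by omega) (by omega), Nat.add_assoc]
  rcases le_total x y with hle | hle
  · obtain ⟨k, hk⟩ := (Nat.modEq_iff_dvd' hle).1 h
    have e : y = x + p * k := by omega
    rw [e] at hyb ⊢
    exact key k x hx hyb
  · obtain ⟨k, hk⟩ := (Nat.modEq_iff_dvd' hle).1 h.symm
    have e : x = y + p * k := by omega
    rw [e] at hxb ⊢
    exact (key k y hy hxb).symm

theorem exists_window (c p x : ℕ) (hp : 1 ≤ p) : ∃ y, c ≤ y ∧ y < c + p ∧ x ≡ y [MOD p] := by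
  refine ⟨c + (x + p * c - c) % p, by omega, ?_, ?_⟩
  · have := Nat.mod_lt (x + p * c - c) hp; omega
  · have hc : c ≤ p * c := Nat.le_mul_of_pos_left c hp
    have h1 : c + (x + p * c - c) % p ≡ c + (x + p * c - c) [MOD p] :=
      Nat.ModEq.add_left c (Nat.mod_modEq _ _)
    rw [show c + (x + p * c - c) = x + p * c by omega] at h1
    refine (h1.trans ?_).symm
    simp [Nat.ModEq]

theorem perOn_extend (f : ℕ → ℕ) (a b c d p g : ℕ) (hp1 : 1 ≤ p) (hg : g ∣ p)
    (hac : a ≤ c) (hdb : d ≤ b) (hcd : c + p ≤ d) (hp : PerOn f a b p) (hgd : PerOn f c d g) :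
    PerOn f a b g := by
  intro x hx hxb
  obtain ⟨y, hy1, hy2, hy3⟩ := exists_window c p x hp1
  obtain ⟨z, hz1, hz2, hz3⟩ := exists_window c p (x + g) hp1
  rw [perOn_mod f a b p hp x y hx (by omega) (by omega) (by omega) hy3,
    perOn_mod f a b p hp (x + g) z (by omega) hxb (by omega) (by omega) hz3]
  refine perOn_mod f c d g hgd y z hy1 (by omega) hz1 (by omega) ?_
  have h1 : x ≡ x + g [MOD g] := by simp [Nat.ModEq]
  exact ((hy3.of_dvd hg).symm.trans h1).trans (hz3.of_dvd hg)

theorem stmt2 (σ n : ℕ) (v : Fin n → Fin σ) (i₁ ℓ₁ p₁ i₂ ℓ₂ p₂ : ℕ)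
    (h₁ : i₁ + ℓ₁ ≤ n) (h₂ : i₂ + ℓ₂ ≤ n)
    (m₁ : IsMajorRun σ n v i₁ ℓ₁ p₁ h₁) (m₂ : IsMajorRun σ n v i₂ ℓ₂ p₂ h₂) :
    i₁ = i₂ ∧ ℓ₁ = ℓ₂ := by
  obtain ⟨⟨⟨a1, b1, c1, d1⟩, r1⟩, l1⟩ := m₁
  obtain ⟨⟨⟨a2, b2, c2, d2⟩, r2⟩, l2⟩ := m₂
  simp only [IsPPeriodic, hasPeriod_iff_perOn] at c1 d1 r1 c2 d2 r2
  generalize extF σ n v = f at *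
  obtain ⟨c, hc⟩ : ∃ c, c = max i₁ i₂ := ⟨_, rfl⟩
  obtain ⟨d, hd⟩ : ∃ d, d = min (i₁ + ℓ₁) (i₂ + ℓ₂) := ⟨_, rfl⟩
  have hov : c + p₁ + p₂ ≤ d := by omega
  have hg := fineWilf f c d _ p₁ p₂ le_rfl a1 a2 hov
    (fun x hx hb => c1 x (by omega) (by omega)) (fun x hx hb => c2 x (by omega) (by omega))
  have hgpos : 1 ≤ Nat.gcd p₁ p₂ := Nat.gcd_pos_of_pos_left _ a1
  have e1 := perOn_extend f i₁ (i₁ + ℓ₁) c d p₁ _ a1 (Nat.gcd_dvd_left p₁ p₂)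
    (by omega) (by omega) (by omega) c1 hg
  have e2 := perOn_extend f i₂ (i₂ + ℓ₂) c d p₂ _ a2 (Nat.gcd_dvd_right p₁ p₂)
    (by omega) (by omega) (by omega) c2 hg
  have g1 : p₁ ≤ Nat.gcd p₁ p₂ := by
    by_contra hh; exact d1 _ hgpos (by omega) e1
  have g2 : p₂ ≤ Nat.gcd p₁ p₂ := by
    by_contra hh; exact d2 _ hgpos (by omega) e2
  have g3 := Nat.gcd_le_left p₂ (show 0 < p₁ from a1)
  have g4 := Nat.gcd_le_right p₁ (show 0 < p₂ from a2)
  obtain rfl : p₁ = p₂ := by omega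
  obtain ⟨A, hA⟩ : ∃ A, A = min i₁ i₂ := ⟨_, rfl⟩
  obtain ⟨L, hL⟩ : ∃ L, A + L = max (i₁ + ℓ₁) (i₂ + ℓ₂) :=
    ⟨max (i₁ + ℓ₁) (i₂ + ℓ₂) - A, by omega⟩
  have hU : PerOn f A (A + L) p₁ := by
    intro x hx hb
    by_cases hq : i₁ ≤ x ∧ x + p₁ < i₁ + ℓ₁
    · exact c1 x hq.1 hq.2
    · exact c2 x (by omega) (by omega)
  have hm : ∀ q, 1 ≤ q → q < p₁ → ¬ PerOn f A (A + L) q := fun q hq1 hq2 H =>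
    d1 q hq1 hq2 (fun x hx hb => H x (by omega) (by omega))
  have k1 : ¬ ℓ₁ < L := fun hh =>
    r1 A L (by omega) (by omega) (by omega) hh ⟨a1, by omega, hU, hm⟩
  have k2 : ¬ ℓ₂ < L := fun hh =>
    r2 A L (by omega) (by omega) (by omega) hh ⟨a1, by omega, hU, hm⟩
  omega
end

section
/- Let k ≥ w ≥ 1 and let v be a string of length w+k that contains two equal k-substrings at distinct positions. Then v contains a major run of length at least p+k, where p is the period of that run. -/
open Finset

theorem stmt3 (σ k w : ℕ) (hw : 1 ≤ w) (hwk : w ≤ k) (v : Fin (w + k) → Fin σ)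
    (hrep : ∃ i j : Fin (w + 1), i ≠ j ∧ kmerAt σ k w v i = kmerAt σ k w v j) :
    ∃ (i ℓ p : ℕ) (h : i + ℓ ≤ w + k),
      IsMajorRun σ (w + k) v i ℓ p h ∧ p + k ≤ ℓ := by 
  classical
  have key : ∃ a d : ℕ, 1 ≤ d ∧ a + d ≤ w ∧ ∀ (t : ℕ) (ht : t < k) (h1 : a + t < w + k)
      (h2 : a + d + t < w + k), v ⟨a + t, h1⟩ = v ⟨a + d + t, h2⟩ := by
    obtain ⟨i, j, hij, he⟩ := hrep
    have hi := i.2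
    have hj := j.2
    have hne : i.1 ≠ j.1 := fun h => hij (Fin.ext h)
    rcases Nat.lt_or_gt_of_ne hne with hlt | hlt
    · refine ⟨i.1, j.1 - i.1, by omega, by omega, fun t ht h1 h2 => ?_⟩
      have := congrFun he ⟨t, ht⟩
      simp only [kmerAt] at this
      rw [this]
      congr 2
      omega
    · refine ⟨j.1, i.1 - j.1, by omega, by omega, fun t ht h1 h2 => ?_⟩
      have := congrFun he ⟨t, ht⟩
      simp only [kmerAt] at this
      rw [← this]
      congr 2
      omega
  obtain ⟨a, d, hd, had, hv⟩ := key
  have h0 : a + (d + k) ≤ w + k := by omega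
  have hex : ∃ p, 1 ≤ p ∧ HasPeriod σ (d + k) (subAt σ (w + k) v a (d + k) h0) p := by
    refine ⟨d, hd, fun t ht => ?_⟩
    have := hv t (by omega) (by omega) (by omega)
    simp only [subAt]
    rw [this]
    congr 2
    omega
  have hpd : Nat.find hex ≤ d := by
    apply Nat.find_min' hex
    refine ⟨hd, fun t ht => ?_⟩
    have := hv t (by omega) (by omega) (by omega)
    simp only [subAt]
    rw [this]
    congr 2
    omega
  obtain ⟨hp1, hpp⟩ := Nat.find_spec hex
  have hmin : ∀ q, 1 ≤ q → q < Nat.find hex →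
      ¬ HasPeriod σ (d + k) (subAt σ (w + k) v a (d + k) h0) q :=
    fun q hq hlt hh => Nat.find_min hex hlt ⟨hq, hh⟩
  generalize Nat.find hex = p at hpd hp1 hpp hmin
  let P : ℕ → Prop := fun ℓ => ∃ (i : ℕ) (h : i + ℓ ≤ w + k), i ≤ a ∧ a + (d + k) ≤ i + ℓ ∧
    IsPPeriodic σ ℓ (subAt σ (w + k) v i ℓ h) p
  have hP0 : P (d + k) := ⟨a, h0, le_rfl, le_rfl, hp1, by omega, hpp, hmin⟩
  have hle : d + k ≤ Nat.findGreatest P (w + k) := Nat.le_findGreatest (by omega) hP0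
  have hspec : P (Nat.findGreatest P (w + k)) := Nat.findGreatest_spec (by omega) hP0
  have hgr : ∀ m, Nat.findGreatest P (w + k) < m → m ≤ w + k → ¬ P m :=
    fun m h1 h2 => Nat.findGreatest_is_greatest h1 h2
  generalize Nat.findGreatest P (w + k) = L at hle hspec hgr
  obtain ⟨i, h, hia, hai, hper⟩ := hspec
  refine ⟨i, L, p, h, ⟨⟨hper, ?_⟩, by omega⟩, by omega⟩
  intro i' l' h' hi' hl' hlt hper'
  exact hgr l' hlt (by omega) ⟨i', h', by omega, by omega, hper'⟩
end

section
/- Let k ≥ w ≥ 1 and let v be a string of length w+k that contains two equal k-substrings at distinct positions. If the major run of v is p-periodic and has length p+k+i, then the number of distinct k-substrings of v equals w−i. -/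
open Finset

def Per {α : Type} (f : ℕ → α) (a b q : ℕ) : Prop :=
  ∀ n, a ≤ n → n + q < b → f n = f (n + q)

theorem Per.mul {α : Type} {f : ℕ → α} {a b q : ℕ} (h : Per f a b q) (t x : ℕ)
    (hx : a ≤ x) (hy : x + q * t < b) : f x = f (x + q * t) := by
  induction t with
  | zero => simp
  | succ t ih =>
    rw [Nat.mul_succ] at hy ⊢
    rw [ih (by omega), h (x + q * t) (by omega) (by omega), Nat.add_assoc]

theorem Per.modEq {α : Type} {f : ℕ → α} {a b q : ℕ} (h : Per f a b q) {x y : ℕ}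
    (hx : a ≤ x) (hxb : x < b) (hy : a ≤ y) (hyb : y < b) (hm : x ≡ y [MOD q]) :
    f x = f y := by
  rcases le_total x y with hl | hl
  · obtain ⟨t, ht⟩ := (Nat.modEq_iff_dvd' hl).1 hm
    obtain rfl : y = x + q * t := by omega
    exact h.mul t x hx hyb
  · obtain ⟨t, ht⟩ := (Nat.modEq_iff_dvd' hl).1 hm.symm
    obtain rfl : x = y + q * t := by omega
    exact (h.mul t y hy hxb).symm

theorem exists_rep (q c n : ℕ) (hq : 1 ≤ q) : ∃ n', c ≤ n' ∧ n' < c + q ∧ n' ≡ n [MOD q] := by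
  refine ⟨c + (n + q * c - c) % q, by omega, by have := Nat.mod_lt (n + q * c - c) hq; omega, ?_⟩
  have h1 : c ≤ q * c := Nat.le_mul_of_pos_left c hq
  have h2 : c + (n + q * c - c) % q ≡ c + (n + q * c - c) [MOD q] :=
    Nat.ModEq.add_left c (Nat.mod_modEq _ _)
  have h3 : c + (n + q * c - c) = n + q * c := by omega
  rw [h3] at h2
  refine h2.trans ?_
  simp [Nat.ModEq]

theorem Per.refine {α : Type} {f : ℕ → α} {a b c d p g : ℕ} (h : Per f a b p) (hp : 1 ≤ p)
    (hg : g ∣ p) (h' : Per f c d g) (hac : a ≤ c) (hdb : d ≤ b) (hcd : c + p ≤ d) :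
    Per f a b g := by
  intro n hn hnb
  obtain ⟨x, hx1, hx2, hx3⟩ := exists_rep p c n hp
  obtain ⟨y, hy1, hy2, hy3⟩ := exists_rep p c (n + g) hp
  have e1 := h.modEq (x := x) (y := n) (by omega) (by omega) (by omega) (by omega) hx3
  have e2 := h.modEq (x := y) (y := n + g) (by omega) (by omega) (by omega) (by omega) hy3
  have e3 : x ≡ y [MOD g] := by
    refine (hx3.of_dvd hg).trans (Nat.ModEq.trans ?_ (hy3.of_dvd hg).symm)
    simp [Nat.ModEq]
  rw [← e1, ← e2]
  exact h'.modEq hx1 (by omega) hy1 (by omega) e3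

theorem Per.sub {α : Type} {f : ℕ → α} {a b p q : ℕ} (hp : Per f a b p) (hq : Per f a b q)
    (hpq : p ≤ q) (hl : a + p + q ≤ b) : Per f a b (q - p) := by
  intro n hn hnb
  by_cases hc : n + q < b
  · have e1 := hq n hn hc
    have e2 := hp (n + (q - p)) (by omega) (by omega)
    rw [e1, e2]; congr 1; omega
  · have e1 := hp (n - p) (by omega) (by omega)
    have e2 := hq (n - p) (by omega) (by omega)
    rw [show n - p + p = n by omega] at e1
    rw [← e1, e2]; congr 1; omega

theorem Per.gcd {α : Type} {f : ℕ → α} {a b : ℕ} : ∀ (N p q : ℕ), p + q ≤ N →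
    Per f a b p → Per f a b q → a + p + q ≤ b → Per f a b (Nat.gcd p q) := by
  intro N
  induction N with
  | zero =>
    intro p q h hp hq _
    obtain rfl : p = 0 := by omega
    simpa using hq
  | succ N ih =>
    intro p q h hp hq hl
    rcases Nat.eq_zero_or_pos p with rfl | hp0
    · simpa using hq
    rcases Nat.eq_zero_or_pos q with rfl | hq0
    · simpa using hp
    rcases le_total p q with hpq | hpq
    · have := ih p (q - p) (by omega) hp (hp.sub hq hpq hl) (by omega)
      rwa [Nat.gcd_sub_self_right hpq] at this
    · have := ih (p - q) q (by omega) (hq.sub hp hpq (by omega)) hq (by omega)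
      rwa [Nat.gcd_sub_self_left hpq] at this

theorem Per.union {α : Type} {f : ℕ → α} {a b c d p : ℕ} (h : Per f a b p) (h' : Per f c d p)
    (h1 : a + p ≤ d) (h2 : c + p ≤ b) (h3 : a + p ≤ b) (h4 : c + p ≤ d) :
    Per f (min a c) (max b d) p := by
  intro n hn hnb
  by_cases hA : a ≤ n ∧ n + p < b
  · exact h n hA.1 hA.2
  · exact h' n (by omega) (by omega)

theorem Per.mono {α : Type} {f : ℕ → α} {a b c d p : ℕ} (h : Per f a b p) (h1 : a ≤ c)
    (h2 : d ≤ b) : Per f c d p := fun n hn hnb => h n (by omega) (by omega)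

theorem hasPeriod_iff {σ n : ℕ} (v : Fin n → Fin σ) (f : ℕ → Fin σ)
    (hf : ∀ j (hj : j < n), f j = v ⟨j, hj⟩) (i ℓ p : ℕ) (h : i + ℓ ≤ n) :
    HasPeriod σ ℓ (subAt σ n v i ℓ h) p ↔ Per f i (i + ℓ) p := by
  constructor
  · intro H x hx hxl
    have := H (x - i) (by omega)
    simp only [subAt] at this
    rw [hf x (by omega), hf (x + p) (by omega)]
    convert this using 3 <;> omega
  · intro H x hx
    have := H (i + x) (by omega) (by omega)
    rw [hf _ (by omega), hf _ (by omega)] at this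
    simp only [subAt]
    convert this using 3
    omega

theorem stmt5 (σ k w : ℕ) (hw : 1 ≤ w) (hwk : w ≤ k) (v : Fin (w + k) → Fin σ)
    (hrep : ∃ i j : Fin (w + 1), i ≠ j ∧ kmerAt σ k w v i = kmerAt σ k w v j)
    (i ℓ p m : ℕ) (h : i + ℓ ≤ w + k) (hmaj : IsMajorRun σ (w + k) v i ℓ p h)
    (hlen : ℓ = p + k + m) :
    numKmers σ k w v = w - m := by
  obtain ⟨f, hf⟩ : ∃ f : ℕ → Fin σ, ∀ j (hj : j < w + k), f j = v ⟨j, hj⟩ :=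
    ⟨fun j => if hj : j < w + k then v ⟨j, hj⟩ else v ⟨0, by omega⟩,
      fun j hj => by simp [hj]⟩
  obtain ⟨⟨⟨hp1, hp2, hper, hmin⟩, hmax⟩, -⟩ := hmaj
  rw [hasPeriod_iff v f hf] at hper
  simp only [hasPeriod_iff v f hf] at hmin
  -- key fact
  have key : ∀ a b, a < b → b ≤ w → (∀ t, t < k → f (a + t) = f (b + t)) →
      i ≤ a ∧ b ≤ i + p + m ∧ p ≤ b - a := by
    intro a b hab hb heq
    have hu : Per f a (b + k) (b - a) := by
      intro n hn hnb
      have := heq (n - a) (by omega)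
      rw [show a + (n - a) = n by omega] at this
      rw [this]; congr 1; omega
    have hg := Per.gcd _ p (b - a) le_rfl
      (hper.mono (c := max i a) (d := min (i + ℓ) (b + k)) (by omega) (by omega))
      (hu.mono (c := max i a) (d := min (i + ℓ) (b + k)) (by omega) (by omega)) (by omega)
    have hx := hper.refine hp1 (Nat.gcd_dvd_left p (b - a)) hg (by omega) (by omega) (by omega)
    have hgp : Nat.gcd p (b - a) = p := by
      by_contra hne
      exact hmin _ (Nat.gcd_pos_of_pos_left _ hp1)
        (lt_of_le_of_ne (Nat.gcd_le_left _ hp1) hne) hx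
    have hdvd : p ∣ b - a := Nat.gcd_eq_left_iff_dvd.1 hgp
    have hple : p ≤ b - a := Nat.le_of_dvd (by omega) hdvd
    rw [hgp] at hg
    have hu' : Per f a (b + k) p :=
      hu.refine (by omega) hdvd hg (by omega) (by omega) (by omega)
    have hU := hper.union hu' (by omega) (by omega) (by omega) (by omega)
    have hcont : ¬ (ℓ < max (i + ℓ) (b + k) - min i a) := by
      intro hlt
      have e : min i a + (max (i + ℓ) (b + k) - min i a) = max (i + ℓ) (b + k) := by omega
      refine hmax (min i a) (max (i + ℓ) (b + k) - min i a) (by omega) (by omega) (by omega)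
        hlt ⟨hp1, by omega, ?_, ?_⟩
      · rw [hasPeriod_iff v f hf, e]; exact hU
      · intro q hq1 hq2
        rw [hasPeriod_iff v f hf, e]
        intro hq
        exact hmin q hq1 hq2 (hq.mono (by omega) (by omega))
    omega
  let K : ℕ → (Fin k → Fin σ) := fun j t => f (j + t.1)
  have hK : ∀ j : Fin (w + 1), kmerAt σ k w v j = K j.1 := by
    intro j; funext t
    have := j.2; have := t.2
    simp only [kmerAt, K]
    rw [hf _ (by omega)]
  have himg : Finset.univ.image (kmerAt σ k w v) =
      (Finset.range (i + p) ∪ Finset.Ico (i + p + m + 1) (w + 1)).image K := by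
    ext s
    simp only [Finset.mem_image, Finset.mem_univ, true_and, Finset.mem_union, Finset.mem_range,
      Finset.mem_Ico]
    constructor
    · rintro ⟨j, rfl⟩
      have := j.2
      rw [hK]
      by_cases hj : j.1 < i + p ∨ (i + p + m + 1 ≤ j.1 ∧ j.1 < w + 1)
      · exact ⟨j.1, hj, rfl⟩
      · obtain ⟨x, hx1, hx2, hx3⟩ := exists_rep p i j.1 hp1
        refine ⟨x, Or.inl hx2, ?_⟩
        funext t
        have := t.2
        exact hper.modEq (by omega) (by omega) (by omega) (by omega) (hx3.add_right _)
    · rintro ⟨j, hj, rfl⟩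
      exact ⟨⟨j, by omega⟩, hK _⟩
  have hinj : Set.InjOn K
      (Finset.range (i + p) ∪ Finset.Ico (i + p + m + 1) (w + 1) : Finset ℕ) := by
    have aux : ∀ a b, a < b → b ≤ w → (b < i + p ∨ i + p + m + 1 ≤ b) → K a = K b → False := by
      intro a b hab hb hb' hE
      have := key a b hab hb (fun t ht => congrFun hE ⟨t, ht⟩)
      omega
    intro a ha b hb hE
    simp only [Finset.coe_union, Set.mem_union, Finset.mem_coe, Finset.mem_range,
      Finset.mem_Ico] at ha hb
    rcases lt_trichotomy a b with hab | hab | hab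
    · exact (aux a b hab (by omega) (by omega) hE).elim
    · exact hab
    · exact (aux b a hab (by omega) (by omega) hE.symm).elim
  unfold numKmers
  rw [himg, Finset.card_image_of_injOn hinj, Finset.card_union_of_disjoint, Finset.card_range,
    Nat.card_Ico]
  · omega
  · rw [Finset.disjoint_left]
    intro x hx hx'
    simp only [Finset.mem_range, Finset.mem_Ico] at hx hx'
    omega
end

section
/- Let σ ≥ 2 and 1 ≤ w ≤ k. Then |Rep_{σ,k,w}| = Σ_{p=1}^{w} Prim_σ(p) · σ^{w−p} · (w−p+1 − (w−p)/σ). -/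
open Finset

namespace Aux

def Per {α : Type} (f : ℕ → α) (a b p : ℕ) : Prop := ∀ j, a ≤ j → j + p < b → f j = f (j + p)

def PrimAt {α : Type} (f : ℕ → α) (i p : ℕ) : Prop := ¬ ∃ d, d ∣ p ∧ d < p ∧ Per f i (i + p) d

variable {α : Type} {f : ℕ → α}

lemma Per.mono {a b c e p : ℕ} (h : Per f a b p) (hc : a ≤ c) (he : e ≤ b) : Per f c e p :=
  fun j h1 h2 => h j (by omega) (by omega)

lemma Per.mul {a b d : ℕ} (h : Per f a b d) (m : ℕ) : Per f a b (d * m) := by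
  induction m with
  | zero => intro j _ _; simp
  | succ m ih =>
    intro j h1 h2
    have e : d * (m + 1) = d * m + d := by ring
    rw [e] at h2 ⊢
    rw [ih j h1 (by omega), h (j + d * m) (by omega) (by omega), Nat.add_assoc]

lemma Per.eq_of_dvd {a b d x y : ℕ} (h : Per f a b d) (hx : a ≤ x) (hxy : x ≤ y) (hy : y < b)
    (hd : d ∣ y - x) : f x = f y := by
  obtain ⟨m, hm⟩ := hd
  have := h.mul m x hx (by omega)
  rw [this]; congr 1; omega

lemma Per.gcd (p q : ℕ) : ∀ {a b : ℕ}, Per f a b p → Per f a b q → a + (p + q) ≤ b →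
    Per f a b (Nat.gcd p q) := by
  induction hs : p + q using Nat.strong_induction_on generalizing p q with
  | _ s ih =>
    intro a b hp hq hab
    rcases Nat.eq_zero_or_pos p with rfl | hp0
    · simpa using hq
    rcases Nat.eq_zero_or_pos q with rfl | hq0
    · simpa using hp
    rcases le_total p q with hle | hle
    · have : Per f a b (q - p) := by
        intro j h1 h2
        by_cases hj : j + q < b
        · rw [hq j h1 hj, hp (j + (q - p)) (by omega) (by omega)]
          congr 1; omega
        · have e1 := hp (j - p) (by omega) (by omega)
          have e2 := hq (j - p) (by omega) (by omega)
          rw [show j - p + p = j by omega] at e1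
          rw [← e1, e2]; congr 1; omega
      have := ih (p + (q - p)) (by omega) p (q - p) rfl hp this (by omega)
      rwa [Nat.gcd_sub_self_right hle] at this
    · have : Per f a b (p - q) := by
        intro j h1 h2
        by_cases hj : j + p < b
        · rw [hp j h1 hj, hq (j + (p - q)) (by omega) (by omega)]
          congr 1; omega
        · have e1 := hq (j - q) (by omega) (by omega)
          have e2 := hp (j - q) (by omega) (by omega)
          rw [show j - q + q = j by omega] at e1
          rw [← e1, e2]; congr 1; omega
      have := ih ((p - q) + q) (by omega) (p - q) q rfl this hq (by omega)
      rwa [Nat.gcd_sub_self_left hle] at this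

lemma Per.left {a b c e p d : ℕ} (h : Per f a b p) (hp : 0 < p) (hd : d ∣ p) (he : e ≤ b)
    (hl : c + p ≤ e) (n : ℕ) (hn : a + n = c) (h2 : Per f c e d) : Per f a e d := by
  induction n generalizing c with
  | zero => exact h2.mono (by omega) le_rfl
  | succ n ih =>
    apply ih (c := c - 1) (by omega) (by omega)
    intro j h3 h4
    have hd0 := Nat.pos_of_dvd_of_pos hd hp
    by_cases hj : c ≤ j
    · exact h2 j hj h4
    · have hle := Nat.le_of_dvd hp hd
      rw [h j (by omega) (by omega)]
      symm
      apply h2.eq_of_dvd (by omega) (by omega) (by omega)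
      rw [show j + p - (j + d) = p - d by omega]
      exact Nat.dvd_sub hd dvd_rfl

lemma Per.right {a b c e p d : ℕ} (h : Per f a b p) (hp : 0 < p) (hd : d ∣ p) (hc : a ≤ c)
    (hl : c + p ≤ e) (n : ℕ) (hn : e + n = b) (h2 : Per f c e d) : Per f c b d := by
  induction n generalizing e with
  | zero => exact h2.mono le_rfl (by omega)
  | succ n ih =>
    apply ih (e := e + 1) (by omega) (by omega)
    intro j h3 h4
    have hd0 := Nat.pos_of_dvd_of_pos hd hp
    by_cases hj : j + d < e
    · exact h2 j h3 hj
    · have hle := Nat.le_of_dvd hp hd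
      have e1 := h (j + d - p) (by omega) (by omega)
      rw [show j + d - p + p = j + d by omega] at e1
      rw [← e1]
      symm
      apply h2.eq_of_dvd (by omega) (by omega) (by omega)
      rw [show j - (j + d - p) = p - d by omega]
      exact Nat.dvd_sub hd dvd_rfl

lemma Per.spread {a b c e p d : ℕ} (h : Per f a b p) (hp : 0 < p) (hd : d ∣ p) (hc : a ≤ c)
    (he : e ≤ b) (hl : c + p ≤ e) (h2 : Per f c e d) : Per f a b d :=
  h.left hp hd le_rfl (by omega) (c - a) (by omega)
    (h.right hp hd hc hl (b - e) (by omega) h2)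

lemma PrimAt.transfer {a b i i' p : ℕ} (h : Per f a b p) (hp : 0 < p) (hi : a ≤ i)
    (hi2 : i + p ≤ b) (hi' : a ≤ i') (hi2' : i' + p ≤ b) (hP : PrimAt f i p) : PrimAt f i' p := by
  rintro ⟨d, h1, h2, h3⟩
  exact hP ⟨d, h1, h2, (h.spread hp h1 hi' hi2' le_rfl h3).mono hi hi2⟩

/-- key uniqueness, one-sided -/
lemma uniq_lt {k w i i' p p' : ℕ} (hwk : w ≤ k) (hp' : 0 < p') (hlt : p' < p)
    (hi : i + p ≤ w) (hi' : i' + p' ≤ w)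
    (h : Per f i (i + k + p) p) (h' : Per f i' (i' + k + p') p') (hP : PrimAt f i p) : False := by
  have hg := Per.gcd p p' (a := max i i') (b := min (i + k + p) (i' + k + p'))
    (h.mono (by omega) (by omega)) (h'.mono (by omega) (by omega)) (by omega)
  have hd := Nat.gcd_dvd_left p p'
  have hle := Nat.le_of_dvd hp' (Nat.gcd_dvd_right p p')
  have := h.spread (by omega) hd (by omega) (by omega) (by omega) hg
  exact hP ⟨_, hd, by omega, this.mono le_rfl (by omega)⟩

def E {σ n : ℕ} [NeZero σ] (v : Fin n → Fin σ) (j : ℕ) : Fin σ := if h : j < n then v ⟨j, h⟩ else 0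

variable {σ : ℕ} [NeZero σ]

lemma E_of_lt {n : ℕ} (v : Fin n → Fin σ) {j : ℕ} (h : j < n) : E v j = v ⟨j, h⟩ := by
  simp [E, h]

lemma E_val {n : ℕ} (v : Fin n → Fin σ) (j : Fin n) : E v j.1 = v j := by
  simp [E]

lemma E_mk {n : ℕ} (g : ℕ → Fin σ) {j : ℕ} (h : j < n) : E (fun x : Fin n => g x.1) j = g j := by
  simp [E, h]

lemma isPrim_iff {n : ℕ} (s : Fin n → Fin σ) : IsPrimitive σ n s ↔ PrimAt (E s) 0 n := by
  unfold IsPrimitive PrimAt HasPeriod Per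
  refine not_congr (exists_congr fun d => and_congr_right fun _ => and_congr_right fun _ => ?_)
  constructor
  · intro h j _ h2
    rw [E_of_lt _ (by omega), E_of_lt _ (by omega)]
    exact h j (by omega)
  · intro h j h2
    have := h j (by omega) (by omega)
    rwa [E_of_lt _ (by omega), E_of_lt _ (by omega)] at this

lemma primAt_shift {β : Type} {g h : ℕ → β} {a b p : ℕ} (e : ∀ x, x < p → g (a + x) = h (b + x))
    (hP : PrimAt g a p) : PrimAt h b p := by
  rintro ⟨d, h1, h2, h3⟩
  refine hP ⟨d, h1, h2, fun j h4 h5 => ?_⟩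
  have e1 := e (j - a) (by omega)
  have e2 := e (j - a + d) (by omega)
  rw [show a + (j - a) = j by omega] at e1
  rw [show a + (j - a + d) = j + d by omega] at e2
  rw [e1, e2, h3 (b + (j - a)) (by omega) (by omega), Nat.add_assoc]

open Classical in
noncomputable def A (σ : ℕ) [NeZero σ] (n L i p : ℕ) : Finset (Fin n → Fin σ) :=
  Finset.univ.filter fun v => Per (E v) i (i + L + p) p ∧ PrimAt (E v) i p

lemma mem_A {n L i p : ℕ} {v : Fin n → Fin σ} :
    v ∈ A σ n L i p ↔ Per (E v) i (i + L + p) p ∧ PrimAt (E v) i p := by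
  simp [A]

def mk {m p : ℕ} (i L n : ℕ) (s : Fin p → Fin σ) (t : Fin m → Fin σ) : Fin n → Fin σ :=
  fun j => (fun j : ℕ => if j < i then E t j else if j < i + L + p then E s ((j - i) % p)
    else E t (j - L - p)) j.1

lemma E_mk' {m p i L n : ℕ} (s : Fin p → Fin σ) (t : Fin m → Fin σ) {j : ℕ} (h : j < n) :
    E (mk i L n s t) j = if j < i then E t j else if j < i + L + p then E s ((j - i) % p)
    else E t (j - L - p) := by
  rw [E_of_lt _ h]; rfl

lemma card_A {n L i p : ℕ} (hp : 0 < p) (h : i + L + p ≤ n) :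
    (A σ n L i p).card = Prim σ p * σ ^ (n - L - p) := by
  classical
  have e1 : Prim σ p = (Finset.univ.filter fun s : Fin p → Fin σ => IsPrimitive σ p s).card := by
    unfold Prim
    rw [Nat.card_eq_fintype_card, Fintype.card_subtype]
  have e2 : σ ^ (n - L - p) = (Finset.univ : Finset (Fin (n - L - p) → Fin σ)).card := by
    simp
  rw [e1, e2, ← Finset.card_product]
  refine Finset.card_nbij'
    (fun v => ((fun x => E v (i + x.1)), (fun x => if x.1 < i then E v x.1 else E v (x.1 + L + p))))
    (fun st => mk i L n st.1 st.2) ?_ ?_ ?_ ?_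
  · intro v hv
    have hv := mem_A.1 hv
    simp only [Finset.coe_product, Finset.coe_filter, Finset.coe_univ, Set.mem_prod,
      Set.mem_ofPred_eq, Finset.mem_univ, true_and, Set.mem_univ, and_true]
    rw [isPrim_iff]
    refine primAt_shift (fun x hx => ?_) hv.2
    rw [E_mk (fun x => E v (i + x)) (by omega)]
    simp
  · rintro ⟨s, t⟩ hst
    simp only [Finset.coe_product, Finset.coe_filter, Finset.coe_univ, Set.mem_prod,
      Set.mem_ofPred_eq, Finset.mem_univ, true_and, Set.mem_univ, and_true] at hst
    rw [isPrim_iff] at hst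
    refine mem_A.2 ⟨?_, ?_⟩
    · intro j h1 h2
      rw [E_mk' _ _ (by omega), E_mk' _ _ (by omega), if_neg (by omega), if_pos (by omega),
        if_neg (by omega), if_pos (by omega), show j + p - i = j - i + p by omega,
        Nat.add_mod_right]
    · refine primAt_shift (fun x hx => ?_) hst
      rw [E_mk' _ _ (by omega), if_neg (by omega), if_pos (by omega), Nat.add_sub_cancel_left,
        Nat.mod_eq_of_lt hx]
      simp
  · intro v hv
    have hv := mem_A.1 hv
    funext j
    beta_reduce
    rw [← E_val (mk _ _ _ _ _), E_mk' _ _ j.2, ← E_val v j]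
    have hj := j.2
    split_ifs with h1 h2
    · rw [E_mk (fun x => if x < i then E v x else E v (x + L + p)) (by omega), if_pos h1]
    · have hlt := Nat.mod_lt (j.1 - i) hp
      rw [E_mk (fun x => E v (i + x)) hlt]
      have hle := Nat.mod_le (j.1 - i) p
      apply hv.1.eq_of_dvd (by omega) (by omega) (by omega)
      rw [show j.1 - (i + (j.1 - i) % p) = (j.1 - i) - (j.1 - i) % p by omega]
      exact Nat.dvd_sub_mod _
    · rw [E_mk (fun x => if x < i then E v x else E v (x + L + p)) (by omega),
        if_neg (by omega)]
      congr 1; omega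
  · rintro ⟨s, t⟩ hst
    refine Prod.ext ?_ ?_
    · funext x
      have hx := x.2
      simp only
      rw [E_mk' _ _ (by omega), if_neg (by omega), if_pos (by omega), Nat.add_sub_cancel_left,
        Nat.mod_eq_of_lt hx, E_val]
    · funext x
      have hx := x.2
      simp only
      split_ifs with h1
      · rw [E_mk' _ _ (by omega), if_pos h1, E_val]
      · rw [E_mk' _ _ (by omega), if_neg (by omega), if_neg (by omega),
          show x.1 + L + p - L - p = x.1 by omega, E_val]

lemma A_inter {n k i p : ℕ} (hp : 0 < p) (hk : 0 < k) :
    A σ n k i p ∩ A σ n k (i + 1) p = A σ n (k + 1) i p := by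
  ext v
  simp only [Finset.mem_inter, mem_A]
  constructor
  · rintro ⟨⟨h1, h2⟩, h3, h4⟩
    refine ⟨fun j a b => ?_, h2⟩
    by_cases hj : j = i
    · subst hj
      exact h1 j a (by omega)
    · exact h3 j (by omega) (by omega)
  · rintro ⟨h1, h2⟩
    exact ⟨⟨h1.mono le_rfl (by omega), h2⟩, h1.mono (by omega) (by omega),
      h2.transfer h1 hp le_rfl (by omega) (by omega) (by omega)⟩

open Classical in
noncomputable def U (σ : ℕ) [NeZero σ] (n k p m : ℕ) : Finset (Fin n → Fin σ) :=
  (Finset.range (m + 1)).biUnion fun i => A σ n k i p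

lemma mem_U {n k p m : ℕ} {v : Fin n → Fin σ} : v ∈ U σ n k p m ↔ ∃ i ≤ m, v ∈ A σ n k i p := by
  simp [U]

lemma card_U {k p : ℕ} {w : ℕ} (hp : 0 < p) (hwk : w ≤ k) (m : ℕ) (hm : m + p ≤ w) :
    (U σ (w + k) k p m).card + m * (Prim σ p * σ ^ (w - p - 1)) =
      (m + 1) * (Prim σ p * σ ^ (w - p)) := by
  classical
  induction m with
  | zero =>
    have : U σ (w + k) k p 0 = A σ (w + k) k 0 p := by
      ext v; simp [mem_U]
    rw [this, card_A hp (by omega), show w + k - k - p = w - p by omega]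
    ring
  | succ m ih =>
    have ih := ih (by omega)
    have e1 : U σ (w + k) k p (m + 1) = U σ (w + k) k p m ∪ A σ (w + k) k (m + 1) p := by
      ext v
      simp only [Finset.mem_union, mem_U]
      constructor
      · rintro ⟨i, hi, h⟩
        rcases Nat.lt_or_ge m i with h1 | h1
        · right; rwa [show i = m + 1 by omega] at h
        · left; exact ⟨i, h1, h⟩
      · rintro (⟨i, hi, h⟩ | h)
        · exact ⟨i, by omega, h⟩
        · exact ⟨_, le_rfl, h⟩
    have e2 : U σ (w + k) k p m ∩ A σ (w + k) k (m + 1) p = A σ (w + k) (k + 1) m p := by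
      rw [← A_inter hp (by omega)]
      ext v
      simp only [Finset.mem_inter, mem_U]
      refine and_congr_left fun h => ⟨?_, fun h => ⟨m, le_rfl, h⟩⟩
      rintro ⟨i, hi, h'⟩
      rw [mem_A] at h h' ⊢
      have hper : Per (E v) m (m + 1 + k + p) p := by
        intro j h1 h2
        by_cases hj : j = m
        · exact h'.1 j (by omega) (by omega)
        · exact h.1 j (by omega) (by omega)
      exact ⟨hper.mono le_rfl (by omega),
        h.2.transfer hper hp (by omega) (by omega) le_rfl (by omega)⟩
    have e3 := Finset.card_union_add_card_inter (U σ (w + k) k p m) (A σ (w + k) k (m + 1) p)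
    rw [← e1, e2, card_A hp (by omega), card_A hp (by omega), show w + k - k - p = w - p by omega,
      show w + k - (k + 1) - p = w - p - 1 by omega] at e3
    linarith

lemma exists_prim {f : ℕ → α} {k w : ℕ} (p : ℕ) : ∀ i, 0 < p → i + p ≤ w →
    Per f i (i + k + p) p → ∃ p' i', 0 < p' ∧ i' + p' ≤ w ∧ Per f i' (i' + k + p') p' ∧
      PrimAt f i' p' := by
  intro i hp hi h
  induction p using Nat.strong_induction_on with
  | _ p ih =>
    by_cases hP : PrimAt f i p
    · exact ⟨p, i, hp, hi, h, hP⟩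
    · unfold PrimAt at hP
      push Not at hP
      obtain ⟨d, h1, h2, h3⟩ := hP
      exact ih d h2 (Nat.pos_of_dvd_of_pos h1 hp) (by omega)
        ((h.spread hp h1 le_rfl (by omega) le_rfl h3).mono le_rfl (by omega))

lemma mem_Rep {k w : ℕ} {v : Fin (w + k) → Fin σ} : v ∈ RepSet σ k w ↔
    ∃ p i, 0 < p ∧ i + p ≤ w ∧ Per (E v) i (i + k + p) p := by
  have key : ∀ i j : Fin (w + 1), i < j → (kmerAt σ k w v i = kmerAt σ k w v j ↔
      Per (E v) i.1 (i.1 + k + (j.1 - i.1)) (j.1 - i.1)) := by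
    intro i j hij
    have hij : i.1 < j.1 := hij
    have hj := j.2
    rw [funext_iff]
    constructor
    · intro h x h1 h2
      have := h ⟨x - i.1, by omega⟩
      unfold kmerAt at this
      rw [← E_of_lt v, ← E_of_lt v] at this
      simp only at this
      rw [show i.1 + (x - i.1) = x by omega] at this
      rw [this]; congr 1; omega
    · intro h x
      have hx := x.2
      unfold kmerAt
      rw [← E_of_lt v, ← E_of_lt v, h (i.1 + x.1) (by omega) (by omega)]
      congr 1; omega
  simp only [RepSet, Finset.mem_filter, Finset.mem_univ, true_and]
  constructor
  · rintro ⟨i, j, hne, h⟩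
    have hi := i.2
    have hj := j.2
    rcases lt_or_gt_of_ne hne with hl | hl
    · have hl' : i.1 < j.1 := hl
      exact ⟨j.1 - i.1, i.1, by omega, by omega, (key i j hl).1 h⟩
    · have hl' : j.1 < i.1 := hl
      exact ⟨i.1 - j.1, j.1, by omega, by omega, (key j i hl).1 h.symm⟩
  · rintro ⟨p, i, h1, h2, h3⟩
    have hl : (⟨i, by omega⟩ : Fin (w + 1)) < ⟨i + p, by omega⟩ := by
      rw [Fin.lt_def]; simp only; omega
    refine ⟨⟨i, by omega⟩, ⟨i + p, by omega⟩, hl.ne, (key _ _ hl).2 ?_⟩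
    simpa using h3

lemma card_Rep {k w : ℕ} (hwk : w ≤ k) :
    (RepSet σ k w).card = ∑ p ∈ Finset.Icc 1 w, (U σ (w + k) k p (w - p)).card := by
  classical
  rw [← Finset.card_biUnion]
  · congr 1
    ext v
    simp only [mem_Rep, Finset.mem_biUnion, mem_U, mem_A, Finset.mem_Icc]
    constructor
    · rintro ⟨p, i, h1, h2, h3⟩
      obtain ⟨p, i, h1, h2, h3, h4⟩ := exists_prim p i h1 h2 h3
      exact ⟨p, ⟨by omega, by omega⟩, i, by omega, h3, h4⟩
    · rintro ⟨p, ⟨h1, h2⟩, i, h3, h4, h5⟩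
      exact ⟨p, i, by omega, by omega, h4⟩
  · intro p hp q hq hpq
    rw [Finset.mem_coe, Finset.mem_Icc] at hp hq
    rw [Function.onFun, Finset.disjoint_left]
    intro v h1 h2
    obtain ⟨i, hi, h1⟩ := mem_U.1 h1
    obtain ⟨j, hj, h2⟩ := mem_U.1 h2
    rw [mem_A] at h1 h2
    rcases lt_or_gt_of_ne hpq with hl | hl
    · exact uniq_lt hwk (by omega) hl (by omega) (by omega) h2.1 h1.1 h2.2
    · exact uniq_lt hwk (by omega) hl (by omega) (by omega) h1.1 h2.1 h1.2

end Aux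

theorem stmt6 (σ k w : ℕ) (hσ : 2 ≤ σ) (hw : 1 ≤ w) (hwk : w ≤ k) :
    ((RepSet σ k w).card : ℝ) =
      ∑ p ∈ Finset.Icc 1 w, (Prim σ p : ℝ) * (σ : ℝ) ^ (w - p) *
        ((w : ℝ) - p + 1 - ((w : ℝ) - p) / σ) := by
  haveI : NeZero σ := ⟨by omega⟩
  have hσ0 : (σ : ℝ) ≠ 0 := by positivity
  rw [Aux.card_Rep hwk, Nat.cast_sum]
  refine Finset.sum_congr rfl fun p hp => ?_
  rw [Finset.mem_Icc] at hp
  have h := Aux.card_U (σ := σ) (k := k) (p := p) (w := w) (by omega) hwk (w - p) (by omega)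
  have h' := congrArg (Nat.cast : ℕ → ℝ) h
  push_cast [Nat.cast_sub hp.2] at h'
  rcases Nat.eq_zero_or_pos (w - p) with h0 | h0
  · have : w = p := by omega
    subst this
    simp at h' ⊢
    exact h'
  · obtain ⟨m, hm⟩ : ∃ m, w - p = m + 1 := ⟨w - p - 1, by omega⟩
    have hm' : (w : ℝ) - p = m + 1 := by
      rw [← Nat.cast_sub hp.2, hm]; push_cast; ring
    rw [hm'] at h' ⊢
    rw [hm] at h' ⊢
    rw [Nat.add_sub_cancel, pow_succ] at h'
    rw [pow_succ]
    field_simp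
    linarith
end

section
/- Let σ ≥ 2 and 1 ≤ w ≤ k. Then Dev_σ(k,w) = Σ_{t=1}^{w} (1/t)·( Prim_σ(t) + Σ_{p=1}^{t−1} Prim_σ(p)·σ^{t−p}·( 2t−2p+1 − (4t−4p−1)/σ + (2t−2p−2)/σ² ) ) − (2/(w+1))·Σ_{p=1}^{w} Prim_σ(p)·σ^{w−p}·(w−p+1 − (w−p)/σ). In particular, for 1 ≤ w ≤ min{k₁,k₂} one has Dev_σ(k₁,w) = Dev_σ(k₂,w). -/
open Finset

namespace Aux8

def Per (V : ℕ → ℕ) (a b p : ℕ) : Prop := ∀ i, a ≤ i → i + p < b → V i = V (i + p)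

def PrimAt (V : ℕ → ℕ) (a p : ℕ) : Prop := ∀ d, d ∣ p → d < p → ¬ Per V a (a + p) d

theorem Per.mono {V : ℕ → ℕ} {a b p a' b' : ℕ} (h : Per V a b p) (ha : a ≤ a') (hb : b' ≤ b) :
    Per V a' b' p := fun i h1 h2 => h i (by omega) (by omega)

theorem Per.mul {V : ℕ → ℕ} {a b p : ℕ} (h : Per V a b p) (m : ℕ) :
    ∀ i, a ≤ i → i + p * m < b → V i = V (i + p * m) := by
  induction m with
  | zero => intro i _ _; simp
  | succ m ih =>
    intro i h1 h2
    rw [Nat.mul_succ] at h2 ⊢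
    rw [ih i h1 (by omega), h (i + p * m) (by omega) (by omega), Nat.add_assoc]

theorem Per.modEq {V : ℕ → ℕ} {a b p : ℕ} (h : Per V a b p) {x y : ℕ} (hx : a ≤ x) (hx' : x < b)
    (hy : a ≤ y) (hy' : y < b) (hxy : x ≡ y [MOD p]) : V x = V y := by
  rcases le_total x y with hle | hle
  · obtain ⟨m, hm⟩ := (Nat.modEq_iff_dvd' hle).1 hxy
    have : y = x + p * m := by omega
    rw [this]; exact h.mul m x hx (by omega)
  · obtain ⟨m, hm⟩ := (Nat.modEq_iff_dvd' hle).1 hxy.symm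
    have : x = y + p * m := by omega
    rw [this]; exact (h.mul m y hy (by omega)).symm

theorem exists_rep (x y q : ℕ) (hq : 1 ≤ q) : ∃ z, x ≤ z ∧ z < x + q ∧ z ≡ y [MOD q] := by
  have hqx : x ≤ q * x := Nat.le_mul_of_pos_left x hq
  refine ⟨x + (y + q * x - x) % q, by omega, ?_, ?_⟩
  · have := Nat.mod_lt (y + q * x - x) hq; omega
  · have h1 : x + (y + q * x - x) % q ≡ x + (y + q * x - x) [MOD q] :=
      (Nat.mod_modEq _ _).add_left x
    have h2 : x + (y + q * x - x) = y + q * x := by omega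
    rw [h2] at h1
    refine h1.trans ?_
    simp [Nat.ModEq]

/-- extend a period of a window of length `q`. -/
theorem Per.extend {V : ℕ → ℕ} {a b q d x : ℕ} (h : Per V a b q) (hq : 1 ≤ q) (hd : d ∣ q)
    (hx : a ≤ x) (hx' : x + q ≤ b) (hw : Per V x (x + q) d) : Per V a b d := by
  intro i h1 h2
  obtain ⟨y, hy1, hy2, hy3⟩ := exists_rep x i q hq
  obtain ⟨z, hz1, hz2, hz3⟩ := exists_rep x (i + d) q hq
  rw [h.modEq h1 (by omega) (by omega : a ≤ y) (by omega) hy3.symm,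
    h.modEq (by omega : a ≤ i + d) (by omega) (by omega : a ≤ z) (by omega) hz3.symm]
  refine hw.modEq hy1 hy2 hz1 hz2 ?_
  have e1 := hy3.of_dvd hd
  have e2 := hz3.of_dvd hd
  refine e1.trans (Nat.ModEq.trans ?_ e2.symm)
  simp [Nat.ModEq]

theorem PrimAt.rot {V : ℕ → ℕ} {a b p x y : ℕ} (h : Per V a b p) (hp : 1 ≤ p) (hx : a ≤ x)
    (hx' : x + p ≤ b) (hy : a ≤ y) (hy' : y + p ≤ b) (hP : PrimAt V x p) : PrimAt V y p := by
  intro d hd hdp hper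
  exact hP d hd hdp ((h.extend hp hd hy hy' hper).mono hx hx')

theorem fine_wilf {V : ℕ → ℕ} {a b : ℕ} : ∀ s p q : ℕ, p + q ≤ s → 1 ≤ p → 1 ≤ q →
    a + p + q ≤ b → Per V a b p → Per V a b q → Per V a b (Nat.gcd p q) := by
  have key : ∀ p q : ℕ, p < q → a + p + q ≤ b → Per V a b p → Per V a b q →
      Per V a b (q - p) := by
    intro p q hpq hb hP hQ i h1 h2
    by_cases hi : a + p ≤ i
    · have e1 := hP (i - p) (by omega) (by omega)
      have e2 := hQ (i - p) (by omega) (by omega)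
      rw [show i - p + p = i by omega] at e1
      rw [show i - p + q = i + (q - p) by omega] at e2
      rw [← e1, e2]
    · have e1 := hQ i h1 (by omega)
      have e2 := hP (i + (q - p)) (by omega) (by omega)
      rw [show i + (q - p) + p = i + q by omega] at e2
      rw [e1, e2]
  intro s
  induction s with
  | zero => intro p q h hp; omega
  | succ s ih =>
    intro p q hs hp hq hb hP hQ
    rcases lt_trichotomy p q with hlt | heq | hlt
    · have := ih p (q - p) (by omega) hp (by omega) (by omega) hP (key p q hlt hb hP hQ)
      rwa [Nat.gcd_sub_self_right hlt.le] at this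
    · subst heq; rwa [Nat.gcd_self]
    · have := ih (p - q) q (by omega) (by omega) hq (by omega)
        (key q p hlt (by omega) hQ hP) hQ
      rwa [Nat.gcd_sub_self_left hlt.le] at this

/-- `[a, n - c)` is a maximal `p`-run. -/
structure Run (V : ℕ → ℕ) (n p a c : ℕ) : Prop where
  per : Per V a (n - c) p
  prim : PrimAt V a p
  left : ¬ (0 < a ∧ V (a - 1) = V (a - 1 + p))
  right : ¬ (0 < c ∧ V (n - c - p) = V (n - c))

theorem Run.key {V : ℕ → ℕ} {w k p a c i j : ℕ} (hwk : w ≤ k) (h : Run V (w + k) p a c)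
    (hp : 1 ≤ p) (hs : p + a + c ≤ w) (hij : i < j) (hj : j ≤ w) (hq : Per V i (j + k) (j - i)) :
    a ≤ i ∧ j + k + c ≤ w + k ∧ p ∣ j - i := by
  obtain ⟨h1, h2, h3, h4⟩ := h
  obtain ⟨q, hqd⟩ : ∃ q, q = j - i := ⟨_, rfl⟩
  obtain ⟨b, hb⟩ : ∃ b, b = w + k - c := ⟨_, rfl⟩
  rw [← hqd] at hq ⊢
  rw [← hb] at h1 h4
  obtain ⟨x, hx⟩ : ∃ x, x = max i a := ⟨_, rfl⟩
  obtain ⟨y, hy⟩ : ∃ y, y = min (j + k) b := ⟨_, rfl⟩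
  have hxy : x + p + q ≤ y := by omega
  have o1 : Per V x y p := h1.mono (by omega) (by omega)
  have o2 : Per V x y q := hq.mono (by omega) (by omega)
  have o3 := fine_wilf _ p q le_rfl hp (by omega) hxy o1 o2
  have hpr : PrimAt V x p := PrimAt.rot h1 hp le_rfl (by omega) (by omega) (by omega) h2
  have hdv : p ∣ q := by
    by_contra hnd
    have hg : Nat.gcd p q < p := by
      refine lt_of_le_of_ne (Nat.le_of_dvd (by omega) (Nat.gcd_dvd_left p q)) ?_
      intro he; exact hnd (he ▸ Nat.gcd_dvd_right p q)
    exact hpr _ (Nat.gcd_dvd_left p q) hg (o3.mono le_rfl (by omega))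
  have hfull : Per V i (j + k) p :=
    hq.extend (by omega) hdv (by omega : i ≤ x) (by omega) (o1.mono le_rfl (by omega))
  refine ⟨?_, ?_, hdv⟩
  · by_contra hlt
    exact h3 ⟨by omega, hfull (a - 1) (by omega) (by omega)⟩
  · by_contra hlt
    refine h4 ⟨by omega, ?_⟩
    have := hfull (b - p) (by omega) (by omega)
    rwa [show b - p + p = b by omega] at this

theorem Run.unique {V : ℕ → ℕ} {w k p a c p' a' c' : ℕ} (hwk : w ≤ k)
    (h : Run V (w + k) p a c) (hp : 1 ≤ p) (hs : p + a + c ≤ w)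
    (h' : Run V (w + k) p' a' c') (hp' : 1 ≤ p') (hs' : p' + a' + c' ≤ w) :
    p = p' ∧ a = a' ∧ c = c' := by
  have gen : ∀ {p a c p' a' c' : ℕ}, Run V (w + k) p a c → 1 ≤ p → p + a + c ≤ w →
      Run V (w + k) p' a' c' → 1 ≤ p' → p' + a' + c' ≤ w → p ∣ p' ∧ a ≤ a' ∧ c ≤ c' := by
    intro p a c p' a' c' h hp hs h' hp' hs'
    have k1 := h.key hwk hp hs (i := a') (j := a' + p') (by omega) (by omega)
      (by rw [show a' + p' - a' = p' by omega]; exact h'.per.mono le_rfl (by omega))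
    have k2 := h.key hwk hp hs (i := w - c' - p') (j := w - c') (by omega) (by omega)
      (by rw [show w - c' - (w - c' - p') = p' by omega]
          exact h'.per.mono (by omega) (by omega))
    refine ⟨?_, k1.1, by omega⟩
    have := k1.2.2
    rwa [show a' + p' - a' = p' by omega] at this
  obtain ⟨a1, a2, a3⟩ := gen h hp hs h' hp' hs'
  obtain ⟨b1, b2, b3⟩ := gen h' hp' hs' h hp hs
  exact ⟨Nat.dvd_antisymm a1 b1, by omega, by omega⟩

theorem exists_run {V : ℕ → ℕ} {w k i j : ℕ} (hwk : w ≤ k) (hij : i < j) (hj : j ≤ w)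
    (hq : Per V i (j + k) (j - i)) :
    ∃ p a c, 1 ≤ p ∧ p + a + c ≤ w ∧ Run V (w + k) p a c := by
  classical
  have hex : ∃ q, 1 ≤ q ∧ ∃ i, i + q ≤ w ∧ Per V i (i + q + k) q :=
    ⟨j - i, by omega, i, by omega, by rwa [show i + (j - i) = j by omega]⟩
  obtain ⟨p, hpd⟩ : ∃ p, p = Nat.find hex := ⟨_, rfl⟩
  obtain ⟨hp, i, hi, hper⟩ := Nat.find_spec hex
  have hmin : ∀ d, d < p → ¬ (1 ≤ d ∧ ∃ i, i + d ≤ w ∧ Per V i (i + d + k) d) :=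
    fun d hd => Nat.find_min hex (hpd ▸ hd)
  rw [← hpd] at hp hi hper
  have hprim : PrimAt V i p := by
    intro d hd hdp hw
    have hd1 : 1 ≤ d := Nat.pos_of_dvd_of_pos hd hp
    exact hmin d hdp ⟨hd1, i, by omega,
      (hper.extend hp hd le_rfl (by omega) hw).mono le_rfl (by omega)⟩
  have hexa : ∃ a, Per V a (i + p + k) p := ⟨i, hper⟩
  obtain ⟨a, had⟩ : ∃ a, a = Nat.find hexa := ⟨_, rfl⟩
  have ha1 : Per V a (i + p + k) p := had ▸ Nat.find_spec hexa
  have hai : a ≤ i := had ▸ Nat.find_min' hexa hper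
  have ha2 : ∀ x, x < a → ¬ Per V x (i + p + k) p :=
    fun x hx => Nat.find_min hexa (had ▸ hx)
  have hexc : ∃ c, c ≤ w - (i + p) ∧ Per V a (w + k - c) p :=
    ⟨w - (i + p), le_rfl, ha1.mono le_rfl (by omega)⟩
  obtain ⟨c, hcd⟩ : ∃ c, c = Nat.find hexc := ⟨_, rfl⟩
  obtain ⟨hc0, hc1⟩ := Nat.find_spec hexc
  have hc2 : ∀ x, x < c → ¬ (x ≤ w - (i + p) ∧ Per V a (w + k - x) p) :=
    fun x hx => Nat.find_min hexc (hcd ▸ hx)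
  rw [← hcd] at hc0 hc1
  refine ⟨p, a, c, hp, by omega, hc1, ?_, ?_, ?_⟩
  · exact PrimAt.rot ha1 hp hai (by omega) le_rfl (by omega) hprim
  · rintro ⟨h0, he⟩
    refine ha2 (a - 1) (by omega) ?_
    intro x hx hx'
    rcases Nat.lt_or_ge x a with hlt | hge
    · rw [show x = a - 1 by omega]; exact he
    · exact ha1 x hge hx'
  · rintro ⟨h0, he⟩
    refine hc2 (c - 1) (by omega) ⟨by omega, ?_⟩
    intro x hx hx'
    rcases Nat.lt_or_ge (x + p) (w + k - c) with hlt | hge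
    · exact hc1 x hx hlt
    · rw [show x + p = w + k - c by omega, show x = w + k - c - p by omega]; exact he

def ext {σ n : ℕ} (v : Fin n → Fin σ) (i : ℕ) : ℕ := if h : i < n then (v ⟨i, h⟩).val else 0

theorem ext_of_lt {σ n : ℕ} (v : Fin n → Fin σ) {i : ℕ} (h : i < n) :
    ext v i = (v ⟨i, h⟩).val := by simp [ext, h]

theorem kmer_eq_iff {σ k w : ℕ} (v : Fin (w + k) → Fin σ) (i j : Fin (w + 1)) (hij : i ≤ j) :
    kmerAt σ k w v i = kmerAt σ k w v j ↔ Per (ext v) i (j + k) (j - i) := by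
  have hij' : i.1 ≤ j.1 := hij
  have hi := i.2
  have hj := j.2
  constructor
  · intro h x hx hx'
    have hlt : x - i.1 < k := by omega
    have := congrFun h ⟨x - i.1, hlt⟩
    simp only [kmerAt] at this
    rw [ext_of_lt v (by omega : x < w + k), ext_of_lt v (by omega : x + (j.1 - i.1) < w + k)]
    have e1 : i.1 + (x - i.1) = x := by omega
    have e2 : j.1 + (x - i.1) = x + (j.1 - i.1) := by omega
    simp only [e1, e2] at this
    rw [this]
  · intro h
    funext x
    have hx := x.2
    have := h (i.1 + x.1) (by omega) (by omega)
    have e2 : i.1 + x.1 + (j.1 - i.1) = j.1 + x.1 := by omega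
    rw [e2, ext_of_lt v (by omega), ext_of_lt v (by omega)] at this
    exact Fin.ext this

theorem mem_RepSet_iff {σ k w : ℕ} (hwk : w ≤ k) (v : Fin (w + k) → Fin σ) :
    v ∈ RepSet σ k w ↔ ∃ p a c, 1 ≤ p ∧ p + a + c ≤ w ∧ Run (ext v) (w + k) p a c := by
  simp only [RepSet, Finset.mem_filter, Finset.mem_univ, true_and]
  constructor
  · rintro ⟨i, j, hne, he⟩
    rcases lt_or_gt_of_ne hne with h | h
    · exact exists_run hwk h (by have := j.2; omega) ((kmer_eq_iff v i j h.le).1 he)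
    · exact exists_run hwk h (by have := i.2; omega) ((kmer_eq_iff v j i h.le).1 he.symm)
  · rintro ⟨p, a, c, hp, hs, hr⟩
    refine ⟨⟨a, by omega⟩, ⟨a + p, by omega⟩, ?_, ?_⟩
    · simp; omega
    · rw [kmer_eq_iff _ _ _ (by simp)]
      simp only [Nat.add_sub_cancel_left]
      exact hr.per.mono le_rfl (by omega)

theorem prob {α β : Type*} [Fintype α] [DecidableEq α] [Fintype β] [LinearOrder β]
    (S : Finset α) (x : α) (hx : x ∈ S) :
    (univ.filter fun ρ : α ≃ β => ∀ y ∈ S, ρ x ≤ ρ y).card * S.card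
      = Fintype.card (α ≃ β) := by
  classical
  have hconst : ∀ z ∈ S, (univ.filter fun ρ : α ≃ β => ∀ y ∈ S, ρ z ≤ ρ y).card =
      (univ.filter fun ρ : α ≃ β => ∀ y ∈ S, ρ x ≤ ρ y).card := by
    intro z hz
    have hsw : ∀ y ∈ S, Equiv.swap x z y ∈ S := by
      intro y hy
      rw [Equiv.swap_apply_def]; split_ifs <;> assumption
    refine Finset.card_bij' (fun ρ _ => (Equiv.swap x z).trans ρ)
      (fun ρ _ => (Equiv.swap x z).trans ρ) ?_ ?_ ?_ ?_
    · intro ρ hρ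
      simp only [mem_filter, mem_univ, true_and, Equiv.trans_apply, Equiv.swap_apply_left] at hρ ⊢
      exact fun y hy => hρ _ (hsw y hy)
    · intro ρ hρ
      simp only [mem_filter, mem_univ, true_and, Equiv.trans_apply, Equiv.swap_apply_right] at hρ ⊢
      exact fun y hy => hρ _ (hsw y hy)
    · intro ρ _; ext; simp
    · intro ρ _; ext; simp
  have hU : (univ : Finset (α ≃ β)) =
      S.biUnion fun z => univ.filter fun ρ : α ≃ β => ∀ y ∈ S, ρ z ≤ ρ y := by
    ext ρ
    simp only [mem_univ, mem_biUnion, mem_filter, true_and, true_iff]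
    exact Finset.exists_min_image S ρ ⟨x, hx⟩
  have hD : (S : Set α).PairwiseDisjoint
      fun z => univ.filter fun ρ : α ≃ β => ∀ y ∈ S, ρ z ≤ ρ y := by
    intro z hz z' hz' hne
    rw [Function.onFun, Finset.disjoint_left]
    intro ρ h1 h2
    simp only [mem_filter, mem_univ, true_and] at h1 h2
    exact hne (ρ.injective (le_antisymm (h1 z' hz') (h2 z hz)))
  have hc := congrArg Finset.card hU
  rw [Finset.card_biUnion hD, Finset.sum_congr rfl hconst, Finset.card_univ] at hc
  rw [hc, Finset.sum_const, smul_eq_mul, mul_comm]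

theorem card_kmers {σ k w p a c : ℕ} (hwk : w ≤ k) (v : Fin (w + k) → Fin σ)
    (h : Run (ext v) (w + k) p a c) (hp : 1 ≤ p) (hs : p + a + c ≤ w) :
    (Finset.univ.image (kmerAt σ k w v)).card = p + a + c := by
  classical
  have hinj : Set.InjOn (kmerAt σ k w v)
      ((univ.filter fun i : Fin (w + 1) => i.1 < a + p ∨ w - c < i.1 : Finset _) : Set _) := by
    have gen : ∀ i j : Fin (w + 1), (i.1 < a + p ∨ w - c < i.1) → (j.1 < a + p ∨ w - c < j.1) →
        i < j → kmerAt σ k w v i ≠ kmerAt σ k w v j := by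
      intro i j hi hj hlt he
      have hlt' : i.1 < j.1 := hlt
      have hj2 := j.2
      obtain ⟨h1, h2, h3⟩ := h.key hwk hp hs hlt' (by omega) ((kmer_eq_iff v i j hlt.le).1 he)
      have := Nat.le_of_dvd (by omega) h3
      omega
    intro i hi j hj he
    simp only [coe_filter, mem_univ, true_and, Set.mem_ofPred_eq] at hi hj
    by_contra hne
    rcases lt_or_gt_of_ne hne with hl | hl
    · exact gen i j hi hj hl he
    · exact gen j i hj hi hl he.symm
  have himg : Finset.univ.image (kmerAt σ k w v) =
      (univ.filter fun i : Fin (w + 1) => i.1 < a + p ∨ w - c < i.1).image (kmerAt σ k w v) := by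
    apply Finset.Subset.antisymm
    · intro u hu
      obtain ⟨i, -, rfl⟩ := mem_image.1 hu
      rw [mem_image]
      by_cases hi : i.1 < a + p ∨ w - c < i.1
      · exact ⟨i, by simp [hi], rfl⟩
      · push Not at hi
        obtain ⟨z, hz1, hz2, hz3⟩ := exists_rep a i.1 p hp
        refine ⟨⟨z, by omega⟩, by simp [hz2], ?_⟩
        have hzi : z ≤ i.1 := by omega
        have hi2 := i.2
        rw [kmer_eq_iff v _ i hzi]
        intro x hx hx'
        simp only at hx hx' ⊢
        refine h.per.modEq (by omega) (by omega) (by omega) (by omega) ?_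
        refine (Nat.modEq_iff_dvd' (by omega)).2 ?_
        rw [Nat.add_sub_cancel_left]
        exact (Nat.modEq_iff_dvd' hzi).1 hz3
    · exact Finset.image_subset_image (Finset.subset_univ _)
  rw [himg, Finset.card_image_of_injOn hinj]
  have hc : (univ.filter fun i : Fin (w + 1) => i.1 < a + p ∨ w - c < i.1).map Fin.valEmbedding =
      Finset.range (a + p) ∪ Finset.Ioc (w - c) w := by
    ext x
    simp only [mem_map, mem_filter, mem_univ, true_and, Fin.valEmbedding_apply, mem_union,
      mem_range, mem_Ioc]
    constructor
    · rintro ⟨i, hi, rfl⟩; have := i.2; omega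
    · intro hx; exact ⟨⟨x, by omega⟩, by simp only; omega, rfl⟩
  rw [← Finset.card_map Fin.valEmbedding, hc, Finset.card_union_of_disjoint, card_range,
    Nat.card_Ioc]
  · omega
  · rw [Finset.disjoint_left]; intro x; simp only [mem_range, mem_Ioc]; omega

theorem Pgc_eq {σ k w p a c : ℕ} (hwk : w ≤ k) (v : Fin (w + k) → Fin σ)
    (h : Run (ext v) (w + k) p a c) (hp : 1 ≤ p) (hs : p + a + c ≤ w) :
    Pgc σ k w v = (1 / ((p + a + c : ℕ) : ℝ)) * (1 + if 0 < c then 1 else 0) := by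
  classical
  have hcard := card_kmers hwk v h hp hs
  set S := Finset.univ.image (kmerAt σ k w v) with hS
  have hN : 0 < Fintype.card ((Fin k → Fin σ) ≃ Fin (σ ^ k)) :=
    Fintype.card_pos_iff.2 ⟨Fintype.equivFinOfCardEq (by simp)⟩
  have hpr : ∀ i, (((univ.filter fun ρ : (Fin k → Fin σ) ≃ Fin (σ ^ k) =>
      ∀ y ∈ S, ρ (kmerAt σ k w v i) ≤ ρ y).card : ℝ)) =
      Fintype.card ((Fin k → Fin σ) ≃ Fin (σ ^ k)) / ((p + a + c : ℕ) : ℝ) := by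
    intro i
    have := prob (β := Fin (σ ^ k)) S (kmerAt σ k w v i) (by simp [hS])
    rw [hcard] at this
    rw [eq_div_iff (by norm_cast; omega)]
    exact_mod_cast this
  have hall : ∀ (ρ : (Fin k → Fin σ) ≃ Fin (σ ^ k)) i,
      (∀ i', ρ (kmerAt σ k w v i) ≤ ρ (kmerAt σ k w v i')) ↔
      (∀ y ∈ S, ρ (kmerAt σ k w v i) ≤ ρ y) := by
    intro ρ i; simp [hS]
  have huniq : (∀ i : Fin (w + 1), kmerAt σ k w v i = kmerAt σ k w v (Fin.last w) →
      i = Fin.last w) ↔ 0 < c := by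
    constructor
    · intro hu
      by_contra hc
      have := hu ⟨w - p, by omega⟩ ((kmer_eq_iff v _ _ (Fin.le_last _)).2 ?_)
      · have := congrArg Fin.val this; simp at this; omega
      · simp only [Fin.val_last]
        rw [show w - (w - p) = p by omega]
        exact h.per.mono (by omega) (by omega)
    · intro hc i he
      by_contra hne
      have hlt : i.1 < w := by
        have := i.2
        have : i.1 ≠ w := fun e => hne (Fin.ext e)
        omega
      have := h.key hwk hp hs hlt le_rfl ((kmer_eq_iff v i _ (Fin.le_last _)).1 he)
      omega
  have hGC : ∀ ρ, IsGC σ k w ρ v ↔ (∀ y ∈ S, ρ (kmerAt σ k w v 0) ≤ ρ y) ∨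
      ((∀ y ∈ S, ρ (kmerAt σ k w v (Fin.last w)) ≤ ρ y) ∧ 0 < c) := by
    intro ρ
    rw [IsGC, huniq, hall, hall]
  have hN' : (Fintype.card ((Fin k → Fin σ) ≃ Fin (σ ^ k)) : ℝ) ≠ 0 := by
    exact_mod_cast hN.ne'
  have ht : ((p + a + c : ℕ) : ℝ) ≠ 0 := by norm_cast; omega
  rw [Pgc, Nat.card_eq_fintype_card, Nat.card_eq_fintype_card, Fintype.card_subtype]
  simp only [hGC]
  rw [Finset.filter_or, Finset.card_union_of_disjoint]
  · by_cases hc : 0 < c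
    · simp only [hc, and_true, if_true]
      rw [Nat.cast_add, hpr, hpr]
      field_simp
    · simp only [hc, and_false, if_false, Finset.filter_false, card_empty, add_zero]
      rw [hpr]
      field_simp
  · rw [Finset.disjoint_left]
    intro ρ h1 h2
    simp only [mem_filter, mem_univ, true_and] at h1 h2
    have e := ρ.injective (le_antisymm (h1 _ (by simp [hS])) (h2.1 (kmerAt σ k w v 0) (by simp [hS])))
    have := huniq.2 h2.2 0 e
    have := congrArg Fin.val this
    simp at this
    omega

theorem prim_iff {σ p a : ℕ} (V : ℕ → ℕ) (s : Fin p → Fin σ)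
    (h : ∀ j : Fin p, V (a + j.1) = (s j).val) : PrimAt V a p ↔ IsPrimitive σ p s := by
  have hP : ∀ d, Per V a (a + p) d ↔ HasPeriod σ p s d := by
    intro d
    constructor
    · intro hper i hi
      have := hper (a + i) (by omega) (by omega)
      rw [Nat.add_assoc, h ⟨i, by omega⟩, h ⟨i + d, hi⟩] at this
      exact Fin.ext this
    · intro hper i hi hi'
      have := hper (i - a) (by omega)
      have e1 := h ⟨i - a, by omega⟩
      have e2 := h ⟨i - a + d, by omega⟩
      simp only at e1 e2
      rw [show a + (i - a) = i by omega] at e1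
      rw [show a + (i - a + d) = i + d by omega] at e2
      rw [e1, e2, this]
  unfold PrimAt IsPrimitive
  simp only [hP]
  push Not
  rfl

open Classical in
noncomputable def Eset (σ n p a c : ℕ) : Finset (Fin n → Fin σ) :=
  univ.filter fun v => Per (ext v) a (n - c) p ∧ PrimAt (ext v) a p

theorem card_Eset {σ n p a c : ℕ} (hp : 1 ≤ p) (hs : p + a + c ≤ n) :
    (Eset σ n p a c).card = Prim σ p * (σ ^ a * σ ^ c) := by
  classical
  have hPrim : Prim σ p = (univ.filter fun s : Fin p → Fin σ => IsPrimitive σ p s).card := by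
    rw [Prim, Nat.card_eq_fintype_card, Fintype.card_subtype]
  have hcard : ((univ.filter fun s : Fin p → Fin σ => IsPrimitive σ p s) ×ˢ
      ((univ : Finset (Fin a → Fin σ)) ×ˢ (univ : Finset (Fin c → Fin σ)))).card =
      Prim σ p * (σ ^ a * σ ^ c) := by
    rw [hPrim]; simp [Finset.card_product]
  rw [← hcard]
  refine Finset.card_bij'
    (fun v _ => (fun j => v ⟨a + j.1, by have := j.2; omega⟩,
      fun j => v ⟨j.1, by have := j.2; omega⟩, fun j => v ⟨n - c + j.1, by have := j.2; omega⟩))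
    (fun x _ i => if h : i.1 < a then x.2.1 ⟨i.1, h⟩ else if h2 : i.1 < n - c then
      x.1 ⟨(i.1 - a) % p, Nat.mod_lt _ hp⟩ else
      x.2.2 ⟨i.1 - (n - c), by have := i.2; omega⟩) ?_ ?_ ?_ ?_
  · intro v hv
    simp only [Eset, mem_filter, mem_univ, true_and, mem_product, and_true] at hv ⊢
    refine (prim_iff (ext v) _ ?_).1 hv.2
    intro j
    rw [ext_of_lt]
  · rintro ⟨s, l, r⟩ hx
    simp only [mem_filter, mem_univ, true_and, mem_product, and_true] at hx
    simp only [Eset, mem_filter, mem_univ, true_and]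
    have hmid : ∀ i, a ≤ i → i < n - c → ext (fun i : Fin n =>
      if h : i.1 < a then l ⟨i.1, h⟩ else if h2 : i.1 < n - c then
      s ⟨(i.1 - a) % p, Nat.mod_lt _ hp⟩ else
      r ⟨i.1 - (n - c), by have := i.2; omega⟩) i =
        (s ⟨(i - a) % p, Nat.mod_lt _ hp⟩).val := by
      intro i h1 h2
      rw [ext_of_lt _ (by omega : i < n)]
      simp [not_lt.2 h1, h2]
    constructor
    · intro i h1 h2
      rw [hmid i h1 (by omega), hmid (i + p) (by omega) h2]
      have : (i + p - a) % p = (i - a) % p := by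
        rw [show i + p - a = i - a + p by omega, Nat.add_mod_right]
      simp only [this]
    · refine (prim_iff _ s ?_).2 hx
      intro j
      rw [hmid _ (by omega) (by have := j.2; omega)]
      simp only [Nat.add_sub_cancel_left, Nat.mod_eq_of_lt j.2]
  · intro v hv
    simp only [Eset, mem_filter, mem_univ, true_and] at hv
    funext i
    have hi := i.2
    simp only
    split_ifs with h1 h2
    · rfl
    · have hm := Nat.mod_lt (i.1 - a) hp
      have := hv.1.modEq (x := a + (i.1 - a) % p) (y := i.1) (by omega) (by omega) (by omega) h2 ?_
      · rw [ext_of_lt v (by omega : a + (i.1 - a) % p < n), ext_of_lt v hi] at this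
        exact Fin.ext this
      · have := (Nat.mod_modEq (i.1 - a) p).add_left a
        rwa [show a + (i.1 - a) = i.1 by omega] at this
    · congr 1
      apply Fin.ext
      simp only
      omega
  · rintro ⟨s, l, r⟩ hx
    refine Prod.ext ?_ (Prod.ext ?_ ?_)
    · funext j
      have hj := j.2
      simp only
      rw [dif_neg (by omega), dif_pos (by omega)]
      simp only [Nat.add_sub_cancel_left, Nat.mod_eq_of_lt j.2]
    · funext j
      simp
    · funext j
      have hj := j.2
      simp only
      rw [dif_neg (by omega), dif_neg (by omega)]
      simp

theorem left_step {V : ℕ → ℕ} {n p a c : ℕ} (hp : 1 ≤ p) (hs : 2 * p + a + c ≤ n) (ha : 0 < a) :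
    ((Per V a (n - c) p ∧ PrimAt V a p) ∧ V (a - 1) = V (a - 1 + p)) ↔
      (Per V (a - 1) (n - c) p ∧ PrimAt V (a - 1) p) := by
  constructor
  · rintro ⟨⟨h1, h2⟩, h3⟩
    have hP : Per V (a - 1) (n - c) p := by
      intro x hx hx'
      rcases Nat.lt_or_ge x a with hlt | hge
      · rw [show x = a - 1 by omega]; exact h3
      · exact h1 x hge hx'
    exact ⟨hP, PrimAt.rot hP hp (by omega : a - 1 ≤ a) (by omega) le_rfl (by omega) h2⟩
  · rintro ⟨h1, h2⟩
    exact ⟨⟨h1.mono (by omega) le_rfl,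
      PrimAt.rot h1 hp le_rfl (by omega) (by omega) (by omega) h2⟩, h1 _ le_rfl (by omega)⟩

theorem right_step {V : ℕ → ℕ} {n p a c : ℕ} (hp : 1 ≤ p) (hs : 2 * p + a + c ≤ n) (hc : 0 < c) :
    ((Per V a (n - c) p ∧ PrimAt V a p) ∧ V (n - c - p) = V (n - c)) ↔
      (Per V a (n - (c - 1)) p ∧ PrimAt V a p) := by
  constructor
  · rintro ⟨⟨h1, h2⟩, h3⟩
    refine ⟨?_, h2⟩
    intro x hx hx'
    rcases Nat.lt_or_ge (x + p) (n - c) with hlt | hge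
    · exact h1 x hx hlt
    · rw [show x + p = n - c by omega, show x = n - c - p by omega]; exact h3
  · rintro ⟨h1, h2⟩
    refine ⟨⟨h1.mono le_rfl (by omega), h2⟩, ?_⟩
    have := h1 (n - c - p) (by omega) (by omega)
    rwa [show n - c - p + p = n - c by omega] at this

/-- `σ^(a-1)` or `0`. -/
noncomputable def e' (σ a : ℕ) : ℝ := if 0 < a then (σ : ℝ) ^ (a - 1) else 0

open Classical in
noncomputable def Rset (σ n p a c : ℕ) : Finset (Fin n → Fin σ) :=
  univ.filter fun v => Run (ext v) n p a c

theorem card_incl_excl {α : Type*} (s : Finset α) (P Q : α → Prop) [DecidablePred P]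
    [DecidablePred Q] :
    ((s.filter fun x => ¬ P x ∧ ¬ Q x).card : ℝ) = s.card - (s.filter P).card - (s.filter Q).card
      + (s.filter fun x => P x ∧ Q x).card := by
  simp only [Finset.card_filter, Finset.card_eq_sum_ones s]
  push_cast
  rw [← Finset.sum_sub_distrib, ← Finset.sum_sub_distrib, ← Finset.sum_add_distrib]
  refine Finset.sum_congr rfl fun x _ => ?_
  by_cases hP : P x <;> by_cases hQ : Q x <;> simp [hP, hQ]

theorem card_Rset {σ n p a c : ℕ} (hp : 1 ≤ p) (hs : 2 * p + a + c ≤ n) :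
    ((Rset σ n p a c).card : ℝ) =
      Prim σ p * (((σ : ℝ) ^ a - e' σ a) * ((σ : ℝ) ^ c - e' σ c)) := by
  classical
  have hE : ∀ a' c', a' ≤ a → c' ≤ c → ((Eset σ n p a' c').card : ℝ) =
      Prim σ p * ((σ : ℝ) ^ a' * (σ : ℝ) ^ c') := by
    intro a' c' ha hc
    rw [card_Eset hp (by omega)]; push_cast; rfl
  have hR : Rset σ n p a c = (Eset σ n p a c).filter fun v =>
      ¬ (0 < a ∧ ext v (a - 1) = ext v (a - 1 + p)) ∧
      ¬ (0 < c ∧ ext v (n - c - p) = ext v (n - c)) := by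
    ext v
    simp only [Rset, Eset, mem_filter, mem_univ, true_and]
    constructor
    · rintro ⟨h1, h2, h3, h4⟩; exact ⟨⟨h1, h2⟩, h3, h4⟩
    · rintro ⟨⟨h1, h2⟩, h3, h4⟩; exact ⟨h1, h2, h3, h4⟩
  have hL : (((Eset σ n p a c).filter fun v =>
      0 < a ∧ ext v (a - 1) = ext v (a - 1 + p)).card : ℝ) =
      Prim σ p * (e' σ a * (σ : ℝ) ^ c) := by
    by_cases ha : 0 < a
    · rw [e', if_pos ha, ← hE (a - 1) c (by omega) le_rfl]
      congr 2
      ext v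
      simp only [Eset, mem_filter, mem_univ, true_and, ha]
      exact left_step hp hs ha
    · simp [e', ha]
  have hRt : (((Eset σ n p a c).filter fun v =>
      0 < c ∧ ext v (n - c - p) = ext v (n - c)).card : ℝ) =
      Prim σ p * ((σ : ℝ) ^ a * e' σ c) := by
    by_cases hc : 0 < c
    · rw [e', if_pos hc, ← hE a (c - 1) le_rfl (by omega)]
      congr 2
      ext v
      simp only [Eset, mem_filter, mem_univ, true_and, hc]
      exact right_step hp hs hc
    · simp [e', hc]
  have hB : (((Eset σ n p a c).filter fun v =>
      (0 < a ∧ ext v (a - 1) = ext v (a - 1 + p)) ∧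
      (0 < c ∧ ext v (n - c - p) = ext v (n - c))).card : ℝ) =
      Prim σ p * (e' σ a * e' σ c) := by
    by_cases ha : 0 < a
    · by_cases hc : 0 < c
      · rw [e', if_pos ha, e', if_pos hc, ← hE (a - 1) (c - 1) (by omega) (by omega)]
        congr 2
        ext v
        simp only [Eset, mem_filter, mem_univ, true_and, ha, hc]
        rw [← and_assoc, left_step hp hs ha, right_step hp (by omega) hc]
      · simp [e', hc]
    · simp [e', ha]
  rw [hR, card_incl_excl, hE a c le_rfl le_rfl, hL, hRt, hB]
  ring

theorem sum_Rep {σ k w : ℕ} (hwk : w ≤ k) (f : (Fin (w + k) → Fin σ) → ℝ) :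
    ∑ v ∈ RepSet σ k w, f v = ∑ t ∈ Icc 1 w, ∑ p ∈ Icc 1 t, ∑ a ∈ range (t - p + 1),
      ∑ v ∈ Rset σ (w + k) p a (t - p - a), f v := by
  classical
  have hU : RepSet σ k w = ((Icc 1 w).sigma fun t => (Icc 1 t).sigma fun p =>
      range (t - p + 1)).biUnion fun x => Rset σ (w + k) x.2.1 x.2.2 (x.1 - x.2.1 - x.2.2) := by
    ext v
    rw [mem_RepSet_iff hwk]
    simp only [mem_biUnion, mem_sigma, mem_Icc, mem_range, Rset, mem_filter, mem_univ, true_and]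
    constructor
    · rintro ⟨p, a, c, hp, hs, hr⟩
      refine ⟨⟨p + a + c, p, a⟩, by simp only; omega, ?_⟩
      simp only
      rwa [show p + a + c - p - a = c by omega]
    · rintro ⟨⟨t, p, a⟩, h, hr⟩
      simp only at h hr
      exact ⟨p, a, t - p - a, by omega, by omega, hr⟩
  rw [hU, Finset.sum_biUnion, Finset.sum_sigma]
  · refine Finset.sum_congr rfl fun t _ => ?_
    rw [Finset.sum_sigma]
  · rintro ⟨t, p, a⟩ h ⟨t', p', a'⟩ h' hne
    rw [Function.onFun, Finset.disjoint_left]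
    intro v h1 h2
    simp only [Finset.mem_coe, mem_sigma, mem_Icc, mem_range] at h h'
    simp only [Rset, mem_filter, mem_univ, true_and] at h1 h2
    obtain ⟨e1, e2, e3⟩ := h1.unique hwk (by omega) (by omega) h2 (by omega) (by omega)
    have e4 : t = t' := by omega
    subst e1 e2 e4
    exact hne rfl

noncomputable def r (σ a : ℕ) : ℝ := (σ : ℝ) ^ a - e' σ a

theorem r_zero (σ : ℕ) : r σ 0 = 1 := by simp [r, e']

theorem r_pos {σ a : ℕ} (hσ : 2 ≤ σ) (ha : 0 < a) : r σ a = (σ : ℝ) ^ a * (1 - 1 / σ) := by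
  have hx : (σ : ℝ) ≠ 0 := by norm_cast; omega
  obtain ⟨b, rfl⟩ : ∃ b, a = b + 1 := ⟨a - 1, by omega⟩
  simp only [r, e', ha, if_true, Nat.add_sub_cancel]
  field_simp
  ring

theorem sum_conv {σ e : ℕ} (hσ : 2 ≤ σ) (g : ℕ → ℝ) (A : ℝ) (hg : ∀ a < e, g (a + 1) = A) :
    ∑ a ∈ range (e + 1 + 1), r σ a * r σ (e + 1 - a) * g a =
      (σ : ℝ) ^ (e + 1) * ((1 - 1 / σ) * (g 0 + g (e + 1)) + e * (1 - 1 / (σ : ℝ)) ^ 2 * A) := by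
  have hmid : ∀ a ∈ range e, r σ (a + 1) * r σ (e + 1 - (a + 1)) * g (a + 1) =
      (σ : ℝ) ^ (e + 1) * (1 - 1 / (σ : ℝ)) ^ 2 * A := by
    intro a ha
    rw [mem_range] at ha
    rw [hg a ha, r_pos hσ (by omega), r_pos hσ (by omega)]
    have : (σ : ℝ) ^ (e + 1) = (σ : ℝ) ^ (a + 1) * (σ : ℝ) ^ (e + 1 - (a + 1)) := by
      rw [← pow_add]; congr 1; omega
    rw [this]; ring
  rw [Finset.sum_range_succ, Finset.sum_range_succ', Finset.sum_congr rfl hmid]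
  simp only [sum_const, card_range, nsmul_eq_mul, Nat.sub_zero, Nat.sub_self, r_zero]
  rw [r_pos hσ (by omega : 0 < e + 1)]
  ring

theorem conv1 {σ D : ℕ} (hσ : 2 ≤ σ) :
    ∑ d ∈ range (D + 1), ∑ a ∈ range (d + 1), r σ a * r σ (d - a) =
      (σ : ℝ) ^ D * (D + 1 - D / σ) := by
  have hx : (σ : ℝ) ≠ 0 := by norm_cast; omega
  induction D with
  | zero => simp [r_zero]
  | succ D ih =>
    rw [Finset.sum_range_succ, ih]
    have := sum_conv (e := D) hσ (fun _ => 1) 1 (fun _ _ => rfl)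
    simp only [mul_one] at this
    rw [this]
    push_cast
    field_simp
    ring

theorem conv2 {σ d : ℕ} (hσ : 2 ≤ σ) (hd : 0 < d) :
    ∑ a ∈ range (d + 1), r σ a * r σ (d - a) * (1 + if 0 < d - a then 1 else 0) =
      (σ : ℝ) ^ d * (2 * d + 1 - (4 * d - 1) / σ + (2 * d - 2) / (σ : ℝ) ^ 2) := by
  have hx : (σ : ℝ) ≠ 0 := by norm_cast; omega
  obtain ⟨e, rfl⟩ : ∃ e, d = e + 1 := ⟨d - 1, by omega⟩
  rw [sum_conv hσ (fun a => 1 + if 0 < e + 1 - a then 1 else 0) 2]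
  · rw [if_pos (by omega : 0 < e + 1 - 0), if_neg (by omega)]
    push_cast
    field_simp
    ring
  · intro a ha
    rw [if_pos (by omega)]; norm_num

theorem sum_P {σ k w : ℕ} (hσ : 2 ≤ σ) (hwk : w ≤ k) :
    ∑ v ∈ RepSet σ k w, Pgc σ k w v = ∑ t ∈ Finset.Icc 1 w, (1 / (t : ℝ)) *
        ((Prim σ t : ℝ) + ∑ p ∈ Finset.Ico 1 t, (Prim σ p : ℝ) * (σ : ℝ) ^ (t - p) *
          (2 * (t : ℝ) - 2 * p + 1 - (4 * (t : ℝ) - 4 * p - 1) / σ +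
            (2 * (t : ℝ) - 2 * p - 2) / (σ : ℝ) ^ 2)) := by
  rw [sum_Rep hwk]
  refine Finset.sum_congr rfl fun t ht => ?_
  rw [mem_Icc] at ht
  have hin : ∀ p ∈ Icc 1 t, ∑ a ∈ range (t - p + 1),
      ∑ v ∈ Rset σ (w + k) p a (t - p - a), Pgc σ k w v =
      (1 / (t : ℝ)) * ((Prim σ p : ℝ) * ∑ a ∈ range (t - p + 1),
        r σ a * r σ (t - p - a) * (1 + if 0 < t - p - a then 1 else 0)) := by
    intro p hp
    rw [mem_Icc] at hp
    rw [Finset.mul_sum, Finset.mul_sum]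
    refine Finset.sum_congr rfl fun a ha => ?_
    rw [mem_range] at ha
    have : ∀ v ∈ Rset σ (w + k) p a (t - p - a), Pgc σ k w v =
        (1 / (t : ℝ)) * (1 + if 0 < t - p - a then 1 else 0) := by
      intro v hv
      simp only [Rset, mem_filter, mem_univ, true_and] at hv
      rw [Pgc_eq hwk v hv hp.1 (by omega), show p + a + (t - p - a) = t by omega]
    rw [Finset.sum_congr rfl this, Finset.sum_const, nsmul_eq_mul,
      card_Rset hp.1 (by omega), r, r]
    ring
  rw [Finset.sum_congr rfl hin, ← Finset.mul_sum]
  congr 1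
  rw [← Finset.Ico_insert_right ht.1, Finset.sum_insert (by simp)]
  congr 1
  · simp [r_zero]
  · refine Finset.sum_congr rfl fun p hp => ?_
    rw [mem_Ico] at hp
    rw [conv2 hσ (by omega), Nat.cast_sub hp.2.le]
    ring

theorem card_Rep {σ k w : ℕ} (hσ : 2 ≤ σ) (hwk : w ≤ k) :
    ((RepSet σ k w).card : ℝ) = ∑ p ∈ Finset.Icc 1 w, (Prim σ p : ℝ) * (σ : ℝ) ^ (w - p) *
          ((w : ℝ) - p + 1 - ((w : ℝ) - p) / σ) := by
  have h := sum_Rep (σ := σ) hwk (fun _ => 1)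
  rw [Finset.sum_const, nsmul_eq_mul, mul_one] at h
  rw [h]
  have h1 : ∑ t ∈ Icc 1 w, ∑ p ∈ Icc 1 t, ∑ a ∈ range (t - p + 1),
      ∑ v ∈ Rset σ (w + k) p a (t - p - a), (1 : ℝ) =
      ∑ t ∈ Icc 1 w, ∑ p ∈ Icc 1 t, (Prim σ p : ℝ) *
        ∑ a ∈ range (t - p + 1), r σ a * r σ (t - p - a) := by
    refine Finset.sum_congr rfl fun t ht => Finset.sum_congr rfl fun p hp => ?_
    rw [Finset.mul_sum]
    refine Finset.sum_congr rfl fun a ha => ?_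
    rw [mem_Icc] at ht hp
    rw [mem_range] at ha
    rw [Finset.sum_const, nsmul_eq_mul, card_Rset hp.1 (by omega), r, r]
    ring
  rw [h1, Finset.sum_comm' (t' := Icc 1 w) (s' := fun p => Icc p w)
    (by intro x y; simp only [mem_Icc]; omega)]
  refine Finset.sum_congr rfl fun p hp => ?_
  rw [mem_Icc] at hp
  rw [← Finset.mul_sum, mul_assoc, ← Nat.cast_sub hp.2, ← conv1 hσ]
  congr 1
  refine Finset.sum_bij' (fun t _ => t - p) (fun d _ => d + p) ?_ ?_ ?_ ?_ ?_
  · intro t ht; simp only [mem_Icc, mem_range] at *; omega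
  · intro t ht; simp only [mem_Icc, mem_range] at *; omega
  · intro t ht; simp only [mem_Icc] at *; omega
  · intro t ht; omega
  · intro t ht; rfl

end Aux8

theorem stmt8 (σ k w : ℕ) (hσ : 2 ≤ σ) (hw : 1 ≤ w) (hwk : w ≤ k) :
    Dev σ k w =
      (∑ t ∈ Finset.Icc 1 w, (1 / (t : ℝ)) *
        ((Prim σ t : ℝ) + ∑ p ∈ Finset.Ico 1 t, (Prim σ p : ℝ) * (σ : ℝ) ^ (t - p) *
          (2 * (t : ℝ) - 2 * p + 1 - (4 * (t : ℝ) - 4 * p - 1) / σ +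
            (2 * (t : ℝ) - 2 * p - 2) / (σ : ℝ) ^ 2))) -
      (2 / ((w : ℝ) + 1)) *
        ∑ p ∈ Finset.Icc 1 w, (Prim σ p : ℝ) * (σ : ℝ) ^ (w - p) *
          ((w : ℝ) - p + 1 - ((w : ℝ) - p) / σ) ∧
    ∀ k₁ k₂ : ℕ, w ≤ k₁ → w ≤ k₂ → Dev σ k₁ w = Dev σ k₂ w := by 
  have main : ∀ k, w ≤ k → Dev σ k w = _ := fun k hk => by
    rw [Dev, Aux8.sum_P hσ hk, Aux8.card_Rep hσ hk]
  exact ⟨main k hwk, fun k₁ k₂ h₁ h₂ => (main k₁ h₁).trans (main k₂ h₂).symm⟩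
end
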